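/- Let H be a unicyclic graph whose unique cycle C_n has length n ≡ 0 or 1 (mod 3), and let G = H_T be obtained by attaching unions of complete graphs at vertices in T ⊆ V(H). Then reg(S/I(G)) = ν(G). -/

import Mathlib

open MvPolynomial

noncomputable section

namespace EdgeIdealReg

open scoped Classical

/-- The edge ideal of a simple graph, in the polynomial ring with variables the vertices. -/
def edgeIdeal (K : Type) [Field K] {V : Type} (G : SimpleGraph V) :
    Ideal (MvPolynomial V K) :=
  Ideal.span { p | ∃ u v : V, G.Adj u v ∧ p = X u * X v }

/-- The edge ideal of the induced subgraph on a set `s` of vertices, viewed inside the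
polynomial ring of the ambient graph (extra variables do not change the regularity). -/
def edgeIdealOn (K : Type) [Field K] {V : Type} (G : SimpleGraph V) (s : Set V) :
    Ideal (MvPolynomial V K) :=
  Ideal.span { p | ∃ u v : V, G.Adj u v ∧ u ∈ s ∧ v ∈ s ∧ p = X u * X v }

/-- The `r`-th symbolic power of an ideal: the intersection over all minimal primes `p` of `I`
of the contraction of `I^r` localized at `p`; concretely,
`f ∈ I^{(r)}` iff for every minimal prime `p` of `I` there is `s ∉ p` with `s * f ∈ I ^ r`. -/
def symbolicPower {R : Type} [CommRing R] (I : Ideal R) (r : ℕ) : Ideal R where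
  carrier := { f | ∀ p ∈ I.minimalPrimes, ∃ s, s ∉ p ∧ s * f ∈ I ^ r }
  zero_mem' := by
    intro p hp
    exact ⟨1, (Ideal.ne_top_iff_one p).mp hp.1.1.ne_top, by simp⟩
  add_mem' := by
    intro a b ha hb p hp
    obtain ⟨s, hs, hsa⟩ := ha p hp
    obtain ⟨t, ht, htb⟩ := hb p hp
    refine ⟨s * t, fun h => ?_, ?_⟩
    · rcases hp.1.1.mem_or_mem h with h' | h'
      · exact hs h'
      · exact ht h'
    · have : s * t * (a + b) = t * (s * a) + s * (t * b) := by ring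
      rw [this]
      exact Ideal.add_mem _ (Ideal.mul_mem_left _ _ hsa) (Ideal.mul_mem_left _ _ htb)
  smul_mem' := by
    intro c f hf p hp
    obtain ⟨s, hs, hsf⟩ := hf p hp
    refine ⟨s, hs, ?_⟩
    have : s * (c • f) = c * (s * f) := by
      simp only [smul_eq_mul]; ring
    rw [this]
    exact Ideal.mul_mem_left _ _ hsf

/-- Symbolic power with an integer exponent, with the convention `I^{(k)} = S` for `k ≤ 0`. -/
def symbolicPowerZ {R : Type} [CommRing R] (I : Ideal R) (k : ℤ) : Ideal R :=
  if k ≤ 0 then ⊤ else symbolicPower I k.toNat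

/-- A graded free resolution of `S/I` over the polynomial ring `S = K[x_v]`:
`⋯ → F_{i+1} → F_i → ⋯ → F_0 = S → S/I → 0`, where `F_i` is a graded free module with
basis elements of degrees `deg i k`, the differentials are given by matrices of homogeneous
polynomials of the appropriate degrees, the image of `F_1 → F_0 = S` is `I`, and the
complex is exact in positive homological degrees. -/
structure GradedFreeResolution {K : Type} [Field K] {σ : Type}
    (I : Ideal (MvPolynomial σ K)) where
  rank : ℕ → ℕ
  deg : (i : ℕ) → Fin (rank i) → ℕ
  rank_zero : rank 0 = 1
  deg_zero : ∀ k, deg 0 k = 0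
  mat : (i : ℕ) → Matrix (Fin (rank i)) (Fin (rank (i + 1))) (MvPolynomial σ K)
  homog : ∀ i k j, mat i k j = 0 ∨
    ∃ e, deg (i + 1) j = deg i k + e ∧ (mat i k j).IsHomogeneous e
  range_zero : ∀ f : MvPolynomial σ K,
    f ∈ I ↔ (fun _ => f) ∈ LinearMap.range (Matrix.mulVecLin (mat 0))
  isExact : ∀ i, LinearMap.ker (Matrix.mulVecLin (mat i)) =
    LinearMap.range (Matrix.mulVecLin (mat (i + 1)))

/-- The Castelnuovo–Mumford regularity of the quotient `S/I` for a homogeneous ideal `I` of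
the polynomial ring: the least `d` such that some graded free resolution of `S/I` has all its
`i`-th syzygies generated in degrees `≤ d + i` (the minimal free resolution realizes the
infimum).  By convention `reg (S/S) = ⊥ = -∞`. -/

def regQuot {K : Type} [Field K] {σ : Type} (I : Ideal (MvPolynomial σ K)) : WithBot ℤ :=
  if I = ⊤ then ⊥
  else ((sInf { d : ℤ | ∃ F : GradedFreeResolution I,
      ∀ i (k : Fin (F.rank i)), (F.deg i k : ℤ) ≤ d + i } : ℤ) : WithBot ℤ)

/-- A set of edges of `G` that forms a matching: pairwise disjoint edges. -/
def IsMatchingSet {V : Type} (G : SimpleGraph V) (M : Finset (Sym2 V)) : Prop :=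
  (M : Set (Sym2 V)) ⊆ G.edgeSet ∧
    (M : Set (Sym2 V)).Pairwise fun e f => ∀ v, v ∈ e → v ∉ f

/-- An induced matching: a matching such that no two of its edges are joined by an edge
of `G`, i.e. it is the edge set of an induced subgraph. -/
def IsInducedMatchingSet {V : Type} (G : SimpleGraph V) (M : Finset (Sym2 V)) : Prop :=
  IsMatchingSet G M ∧
    (M : Set (Sym2 V)).Pairwise fun e f => ∀ u v, u ∈ e → v ∈ f → ¬G.Adj u v

/-- The matching number `mat(G)`. -/
def matchingNumber {V : Type} (G : SimpleGraph V) : ℕ :=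
  sSup { n | ∃ M, IsMatchingSet G M ∧ M.card = n }

/-- The induced matching number `ν(G)`. -/
def inducedMatchingNumber {V : Type} (G : SimpleGraph V) : ℕ :=
  sSup { n | ∃ M, IsInducedMatchingSet G M ∧ M.card = n }

/-- `G` has an induced cycle of length `n`. -/
def HasInducedCycle {V : Type} (G : SimpleGraph V) (n : ℕ) : Prop :=
  ∃ f : ZMod n → V, Function.Injective f ∧
    ∀ i j : ZMod n, G.Adj (f i) (f j) ↔ (j = i + 1 ∨ i = j + 1)

/-- A graph is chordal if every induced cycle has length `3`. -/
def Chordal {V : Type} (G : SimpleGraph V) : Prop :=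
  ∀ n, 4 ≤ n → ¬HasInducedCycle G n

/-- A graph is weakly chordal if every induced cycle in `G` and in `Gᶜ` has length at most 4. -/
def WeaklyChordal {V : Type} (G : SimpleGraph V) : Prop :=
  (∀ n, 5 ≤ n → ¬HasInducedCycle G n) ∧ ∀ n, 5 ≤ n → ¬HasInducedCycle Gᶜ n

/-- The co-chordal cover number `cochord(G)`: the least `n` such that `n` co-chordal
subgraphs of `G` cover all the edges of `G`. -/
def cochordNumber {V : Type} (G : SimpleGraph V) : ℕ :=
  sInf { n | ∃ H : Fin n → SimpleGraph V,
    (∀ i, H i ≤ G ∧ Chordal (H i)ᶜ) ∧ ∀ e ∈ G.edgeSet, ∃ i, e ∈ (H i).edgeSet }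

/-- A graph is unicyclic if it contains exactly one cycle. -/
def Unicyclic {V : Type} (G : SimpleGraph V) : Prop :=
  ∃ (v : V) (c : G.Walk v v), c.IsCycle ∧
    ∀ (w : V) (c' : G.Walk w w), c'.IsCycle → { e | e ∈ c'.edges } = { e | e ∈ c.edges }

/-- Data exhibiting `G` as the graph `H_T` obtained from the induced subgraph on `Hset`
by attaching, at each vertex of `T ⊆ Hset`, a union of complete graphs having that vertex as
their only common vertex: a family of cliques `C i` of `G`, each meeting `Hset` exactly in
its attachment vertex `a i ∈ T`, two distinct cliques meeting in at most the common
attachment vertex, together covering all vertices outside `Hset`, and all edges of `G`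
lying either inside `Hset` or inside one of the cliques. -/
structure CliqueAttachment {V : Type} (G : SimpleGraph V) (Hset T : Set V) where
  ι : Type
  C : ι → Finset V
  a : ι → V
  a_mem_T : ∀ i, a i ∈ T
  T_sub : T ⊆ Hset
  inter_H : ∀ i, (C i : Set V) ∩ Hset = {a i}
  a_mem_C : ∀ i, a i ∈ C i
  clique : ∀ i, G.IsClique (C i)
  pairwise_inter : ∀ i j, i ≠ j → (C i : Set V) ∩ (C j : Set V) ⊆ ({a i} : Set V)
  cover : Hset ∪ (⋃ i, (C i : Set V)) = Set.univ
  edges_sub : ∀ u v, G.Adj u v → (u ∈ Hset ∧ v ∈ Hset) ∨ ∃ i, u ∈ C i ∧ v ∈ C i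

end EdgeIdealReg
namespace EdgeIdealReg
open scoped Classical

section Algebra
variable {K V : Type} [Field K]

/-- `f` is homogeneous of degree `j - s` (zero if `j < s`). -/
def HH (j s : ℕ) (f : MvPolynomial V K) : Prop :=
  f = 0 ∨ ∃ e, j = s + e ∧ f.IsHomogeneous e

lemma HH.zero (j s : ℕ) : HH j s (0 : MvPolynomial V K) := Or.inl rfl

lemma HH.add {j s : ℕ} {f g : MvPolynomial V K} (hf : HH j s f) (hg : HH j s g) :
    HH j s (f + g) := by
  rcases hf with rfl | ⟨e, he, hf⟩
  · simpa using hg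
  rcases hg with rfl | ⟨e', he', hg⟩
  · rw [add_zero]; exact Or.inr ⟨e, he, hf⟩
  have : e = e' := by omega
  subst this
  exact Or.inr ⟨e, he, hf.add hg⟩

lemma HH.neg {j s : ℕ} {f : MvPolynomial V K} (hf : HH j s f) : HH j s (-f) := by
  rcases hf with rfl | ⟨e, he, hf⟩
  · left; simp
  exact Or.inr ⟨e, he, hf.neg⟩

lemma HH.sub {j s : ℕ} {f g : MvPolynomial V K} (hf : HH j s f) (hg : HH j s g) :
    HH j s (f - g) := by
  rw [sub_eq_add_neg]; exact hf.add hg.neg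

lemma HH.mul {j s t : ℕ} {f g : MvPolynomial V K} (hf : HH j s f) (hg : HH s t g) :
    HH j t (f * g) := by
  rcases hf with rfl | ⟨e, he, hf⟩
  · left; simp
  rcases hg with rfl | ⟨e', he', hg⟩
  · left; simp
  exact Or.inr ⟨e + e', by omega, hf.mul hg⟩

lemma HH.sum {ι : Type} {j s : ℕ} {A : Finset ι} {f : ι → MvPolynomial V K}
    (h : ∀ a ∈ A, HH j s (f a)) : HH j s (∑ a ∈ A, f a) := by
  induction A using Finset.induction_on with
  | empty => simpa using HH.zero j s
  | insert a A ha ih =>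
    rw [Finset.sum_insert ha]
    exact (h a (Finset.mem_insert_self _ _)).add
      (ih fun b hb => h b (Finset.mem_insert_of_mem hb))

lemma HH.shift {j s r : ℕ} {f : MvPolynomial V K} (h : HH j s f) : HH (j + r) (s + r) f := by
  rcases h with rfl | ⟨e, he, hf⟩
  · exact HH.zero _ _
  exact Or.inr ⟨e, by omega, hf⟩

lemma HH.unshift {j s r : ℕ} {f : MvPolynomial V K} (h : HH (j + r) (s + r) f) : HH j s f := by
  rcases h with rfl | ⟨e, he, hf⟩
  · exact HH.zero _ _
  exact Or.inr ⟨e, by omega, hf⟩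

lemma HH.eq_zero {j s : ℕ} {f : MvPolynomial V K} (h : HH j s f) (hjs : j < s) : f = 0 := by
  rcases h with rfl | ⟨e, he, hf⟩
  · rfl
  omega

/-- Projection to the part of degree `j - s`. -/
def prj (j s : ℕ) : MvPolynomial V K →ₗ[K] MvPolynomial V K :=
  if s ≤ j then homogeneousComponent (j - s) else 0

lemma prj_HH (j s : ℕ) (f : MvPolynomial V K) : HH j s (prj j s f) := by
  unfold prj
  split_ifs with h
  · exact Or.inr ⟨j - s, by omega, homogeneousComponent_isHomogeneous _ _⟩
  · exact HH.zero _ _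

lemma prj_eq_self {j s : ℕ} {f : MvPolynomial V K} (h : HH j s f) : prj j s f = f := by
  rcases h with rfl | ⟨e, he, hf⟩
  · simp
  subst he
  simp only [prj, Nat.le_add_right, if_true, Nat.add_sub_cancel_left]
  exact homogeneousComponent_eq_self hf

lemma hc_mul {e n : ℕ} {a : MvPolynomial V K} (ha : a.IsHomogeneous e) (f : MvPolynomial V K) :
    homogeneousComponent (e + n) (a * f) = a * homogeneousComponent n f := by
  have h1 : a * f = ∑ i ∈ Finset.range (f.totalDegree + 1), a * homogeneousComponent i f := by
    rw [← Finset.mul_sum, sum_homogeneousComponent]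
  rw [h1, map_sum]
  have h2 : ∀ i, homogeneousComponent (e + n) (a * homogeneousComponent i f)
      = if i = n then a * homogeneousComponent n f else 0 := by
    intro i
    rw [homogeneousComponent_of_mem
      ((mem_homogeneousSubmodule _ _).2 (ha.mul (homogeneousComponent_isHomogeneous i f)))]
    by_cases h : i = n
    · subst h; simp
    · rw [if_neg (by omega), if_neg h]
  simp only [h2]
  rw [Finset.sum_ite_eq']
  split_ifs with h
  · rfl
  · rw [homogeneousComponent_eq_zero, mul_zero]
    simp at h; omega

lemma hc_mul_lt {e n : ℕ} {a : MvPolynomial V K} (ha : a.IsHomogeneous e) (f : MvPolynomial V K)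
    (h : n < e) : homogeneousComponent n (a * f) = 0 := by
  have h1 : a * f = ∑ i ∈ Finset.range (f.totalDegree + 1), a * homogeneousComponent i f := by
    rw [← Finset.mul_sum, sum_homogeneousComponent]
  rw [h1, map_sum]
  apply Finset.sum_eq_zero
  intro i _
  rw [homogeneousComponent_of_mem
      ((mem_homogeneousSubmodule _ _).2 (ha.mul (homogeneousComponent_isHomogeneous i f)))]
  rw [if_neg (by omega)]

lemma prj_mul {j s t : ℕ} {a : MvPolynomial V K} (ha : HH s t a) (f : MvPolynomial V K) :
    prj j t (a * f) = a * prj j s f := by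
  rcases ha with rfl | ⟨e, he, ha⟩
  · simp
  subst he
  unfold prj
  by_cases h : t + e ≤ j
  · obtain ⟨n, rfl⟩ := Nat.exists_eq_add_of_le h
    rw [if_pos (by omega), if_pos h]
    have h1 : t + e + n - t = e + n := by omega
    have h2 : t + e + n - (t + e) = n := by omega
    rw [h1, h2, hc_mul ha]
  · rw [if_neg h]
    by_cases h' : t ≤ j
    · rw [if_pos h', hc_mul_lt ha _ (by omega)]; simp
    · rw [if_neg h']; simp

/-- graded lifting along a homogeneous matrix -/
lemma graded_lift {B C : Type} [Fintype C] (m : Matrix B C (MvPolynomial V K))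
    (db : B → ℕ) (dc : C → ℕ) (hm : ∀ k j, HH (dc j) (db k) (m k j)) (s : ℕ)
    (b : B → MvPolynomial V K) (hb : ∀ k, HH s (db k) (b k))
    (hr : b ∈ LinearMap.range (Matrix.mulVecLin m)) :
    ∃ w : C → MvPolynomial V K, (∀ j, HH s (dc j) (w j)) ∧ m.mulVec w = b := by
  obtain ⟨w, hw⟩ := hr
  refine ⟨fun j => prj s (dc j) (w j), fun j => prj_HH _ _ _, ?_⟩
  funext k
  rw [← prj_eq_self (hb k), ← hw]
  simp only [Matrix.mulVecLin_apply, Matrix.mulVec, dotProduct, map_sum]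
  refine Finset.sum_congr rfl fun j _ => ?_
  rw [prj_mul (hm k j)]

end Algebra
end EdgeIdealReg

namespace EdgeIdealReg
open scoped Classical

section Horseshoe
variable {K V : Type} [Field K]

/-- A light notion of graded module. -/
structure GM (K V : Type) [Field K] where
  M : Type
  [grp : AddCommGroup M]
  [mod : Module (MvPolynomial V K) M]
  gr : ℕ → AddSubgroup M
  smul_mem : ∀ (j s : ℕ) (p : MvPolynomial V K) (m : M), HH j s p → m ∈ gr s → p • m ∈ gr j

attribute [instance] GM.grp GM.mod

/-- The polynomial ideal with degrees shifted by `s`. -/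
abbrev idGM (I : Ideal (MvPolynomial V K)) (s : ℕ) : GM K V where
  M := I
  gr j :=
    { carrier := {w | HH j s w.1}
      zero_mem' := HH.zero _ _
      add_mem' := fun ha hb => HH.add ha hb
      neg_mem' := fun ha => HH.neg ha }
  smul_mem := by
    intro j s p m hp hm
    exact HH.mul hp hm

/-- A submodule of a graded free module. -/
abbrev subF {B : Type} (deg : B → ℕ) (N : Submodule (MvPolynomial V K) (B → MvPolynomial V K)) :
    GM K V where
  M := N
  gr j :=
    { carrier := {w | ∀ b, HH j (deg b) (w.1 b)}
      zero_mem' := fun b => HH.zero _ _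
      add_mem' := fun ha hb b => (ha b).add (hb b)
      neg_mem' := fun ha b => (ha b).neg }
  smul_mem := by
    intro j s p m hp hm b
    exact HH.mul hp (hm b)

/-- The kernel of the presentation given by the generators `g`. -/
def kerSub {X : Type} [AddCommGroup X] [Module (MvPolynomial V K) X] {B : Type} [Fintype B]
    (g : B → X) : Submodule (MvPolynomial V K) (B → MvPolynomial V K) :=
  LinearMap.ker (Fintype.linearCombination (MvPolynomial V K) g)

lemma mem_kerSub {X : Type} [AddCommGroup X] [Module (MvPolynomial V K) X] {B : Type} [Fintype B]
    (g : B → X) (w : B → MvPolynomial V K) : w ∈ kerSub g ↔ ∑ b, w b • g b = 0 := by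
  simp [kerSub, Fintype.linearCombination_apply]

abbrev kerGM (X : GM K V) {B : Type} [Fintype B] (deg : B → ℕ) (g : B → X.M) : GM K V :=
  subF deg (kerSub g)

lemma GM.sum_mem (X : GM K V) {B : Type} [Fintype B] (deg : B → ℕ) (g : B → X.M)
    (hg : ∀ b, g b ∈ X.gr (deg b)) (w : B → MvPolynomial V K) (j : ℕ)
    (hw : ∀ b, HH j (deg b) (w b)) : ∑ b, w b • g b ∈ X.gr j :=
  _root_.sum_mem fun b _ => X.smul_mem _ _ _ _ (hw b) (hg b)

def HasRes : ℕ → GM K V → ℕ → Prop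
  | 0, X, _ => ∀ m : X.M, m = 0
  | n + 1, X, d => ∃ (B : Type) (_ : Fintype B) (deg : B → ℕ) (g : B → X.M),
      (∀ b, deg b ≤ d) ∧ (∀ b, g b ∈ X.gr (deg b)) ∧
      (∀ m : X.M, ∃ w : B → MvPolynomial V K, ∑ b, w b • g b = m) ∧
      (∀ j, ∀ m ∈ X.gr j, ∃ w : B → MvPolynomial V K,
        (∀ b, HH j (deg b) (w b)) ∧ ∑ b, w b • g b = m) ∧
      HasRes n (kerGM X deg g) (d + 1)

lemma HasRes.succ {n : ℕ} : ∀ {X : GM K V} {d : ℕ}, HasRes n X d → HasRes (n + 1) X d := by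
  induction n with
  | zero =>
    intro X d h
    refine ⟨Empty, inferInstance, Empty.elim, Empty.elim, fun b => b.elim, fun b => b.elim,
      fun m => ⟨Empty.elim, by simpa using (h m).symm⟩,
      fun j m _ => ⟨Empty.elim, fun b => b.elim, by simpa using (h m).symm⟩, ?_⟩
    intro m
    apply Subtype.ext
    funext b
    exact b.elim
  | succ n ih =>
    rintro X d ⟨B, fB, deg, g, h1, h2, h3, h4, h5⟩
    exact ⟨B, fB, deg, g, h1, h2, h3, h4, ih h5⟩

lemma HasRes.mono_len {n m : ℕ} (hnm : n ≤ m) {X : GM K V} {d : ℕ} (h : HasRes n X d) :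
    HasRes m X d := by
  induction hnm with
  | refl => exact h
  | step _ ih => exact ih.succ

lemma HasRes.mono {n : ℕ} : ∀ {X : GM K V} {d d' : ℕ}, d ≤ d' → HasRes n X d → HasRes n X d' := by
  induction n with
  | zero => intro X d d' _ h; exact h
  | succ n ih =>
    rintro X d d' hd ⟨B, fB, deg, g, h1, h2, h3, h4, h5⟩
    exact ⟨B, fB, deg, g, fun b => (h1 b).trans hd, h2, h3, h4, ih (by omega) h5⟩

/-- invariance under isomorphism and shift -/
lemma HasRes.shift {n : ℕ} (s : ℕ) : ∀ {X Y : GM K V} {d : ℕ}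
    (e : X.M ≃ₗ[MvPolynomial V K] Y.M)
    (_ : ∀ j m, m ∈ X.gr j ↔ e m ∈ Y.gr (j + s))
    (_ : ∀ j m, j < s → m ∈ Y.gr j → m = 0),
    HasRes n X d → HasRes n Y (d + s) := by
  induction n with
  | zero =>
    intro X Y d e _ _ h m
    have := h (e.symm m)
    simpa using congrArg e this
  | succ n ih =>
    rintro X Y d e he h0 ⟨B, fB, deg, g, h1, h2, h3, h4, h5⟩
    have hsum : ∀ w : B → MvPolynomial V K, ∑ b, w b • e (g b) = e (∑ b, w b • g b) := by
      intro w; simp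
    refine ⟨B, fB, fun b => deg b + s, fun b => e (g b), fun b => by simpa using h1 b,
      fun b => (he _ _).1 (h2 b), ?_, ?_, ?_⟩
    · intro m
      obtain ⟨w, hw⟩ := h3 (e.symm m)
      exact ⟨w, by rw [hsum, hw]; simp⟩
    · intro j m hm
      by_cases hj : j < s
      · refine ⟨0, fun b => HH.zero _ _, ?_⟩
        rw [h0 j m hj hm]; simp
      · obtain ⟨i, rfl⟩ := Nat.exists_eq_add_of_le (not_lt.1 hj)
        rw [add_comm s i] at *
        obtain ⟨w, hw1, hw⟩ := h4 i (e.symm m) (by rw [he]; simpa using hm)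
        exact ⟨w, fun b => (hw1 b).shift, by rw [hsum, hw]; simp⟩
    · have hk : kerSub (K := K) (V := V) g = kerSub (fun b => e (g b)) := by
        ext w
        rw [mem_kerSub, mem_kerSub, hsum]
        exact e.map_eq_zero_iff.symm
      have := ih (X := kerGM X deg g) (Y := kerGM Y (fun b => deg b + s) (fun b => e (g b)))
        (LinearEquiv.ofEq _ _ hk) ?_ ?_ h5
      · rwa [show d + s + 1 = d + 1 + s by omega]
      · intro j m
        constructor
        · intro h b
          exact (h b).shift
        · intro h b
          exact (h b).unshift
      · intro j m hj h
        apply Subtype.ext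
        funext b
        exact (h b).eq_zero (show j < deg b + s by omega)

/-- Horseshoe lemma. -/
lemma HasRes.horseshoe {n : ℕ} : ∀ {X' X X'' : GM K V} {d : ℕ}
    (i : X'.M →ₗ[MvPolynomial V K] X.M) (p : X.M →ₗ[MvPolynomial V K] X''.M)
    (_ : Function.Injective i) (_ : ∀ m, p m = 0 ↔ ∃ m', i m' = m)
    (_ : Function.Surjective p)
    (_ : ∀ j m, i m ∈ X.gr j ↔ m ∈ X'.gr j) (_ : ∀ j m, m ∈ X.gr j → p m ∈ X''.gr j)
    (_ : ∀ j, ∀ m'' ∈ X''.gr j, ∃ m ∈ X.gr j, p m = m''),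
    HasRes n X' d → HasRes n X'' d → HasRes n X d := by
  induction n with
  | zero =>
    intro X' X X'' d i p hi hex hp _ _ _ h' h'' m
    obtain ⟨m', rfl⟩ := (hex m).1 (h'' _)
    rw [h' m', map_zero]
  | succ n ih =>
    rintro X' X X'' d i p hi hex hp hgi hgp hgs ⟨B', fB', deg', g', h1', h2', h3', h4', h5'⟩
      ⟨B'', fB'', deg'', g'', h1'', h2'', h3'', h4'', h5''⟩
    choose t ht1 ht2 using fun b => hgs _ (g'' b) (h2'' b)
    have hsum : ∀ w : B' ⊕ B'' → MvPolynomial V K,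
        ∑ b, w b • (Sum.elim (fun b => i (g' b)) t b : X.M)
          = i (∑ b, w (Sum.inl b) • g' b) + ∑ b, w (Sum.inr b) • t b := by
      intro w
      rw [Fintype.sum_sum_type]
      simp
    have hpt : ∀ w : B'' → MvPolynomial V K,
        p (∑ b, w b • t b) = ∑ b, w b • g'' b := by
      intro w; simp [ht2]
    have hpi : ∀ m, p (i m) = 0 := fun m => (hex _).2 ⟨m, rfl⟩
    have htm : ∀ (j : ℕ) (w : B'' → MvPolynomial V K), (∀ b, HH j (deg'' b) (w b)) →
        ∑ b, w b • t b ∈ X.gr j := fun j w hw => X.sum_mem deg'' t ht1 w j hw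
    refine ⟨B' ⊕ B'', inferInstance, Sum.elim deg' deg'', Sum.elim (fun b => i (g' b)) t,
      ?_, ?_, ?_, ?_, ?_⟩
    · rintro (b | b)
      · exact h1' b
      · exact h1'' b
    · rintro (b | b)
      · exact (hgi _ _).2 (h2' b)
      · exact ht1 b
    · intro m
      obtain ⟨w'', hw''⟩ := h3'' (p m)
      obtain ⟨m', hm'⟩ := (hex (m - ∑ b, w'' b • t b)).1 (by rw [map_sub, hpt, hw'', sub_self])
      obtain ⟨w', hw'⟩ := h3' m'
      refine ⟨Sum.elim w' w'', ?_⟩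
      rw [hsum]
      simp [hw', hm']
    · intro j m hm
      obtain ⟨w'', hh'', hw''⟩ := h4'' j (p m) (hgp _ _ hm)
      obtain ⟨m', hm'⟩ := (hex (m - ∑ b, w'' b • t b)).1 (by rw [map_sub, hpt, hw'', sub_self])
      obtain ⟨w', hh', hw'⟩ := h4' j m' (by
        rw [← hgi, hm']; exact sub_mem hm (htm _ _ hh''))
      refine ⟨Sum.elim w' w'', ?_, ?_⟩
      · rintro (b | b)
        · exact hh' b
        · exact hh'' b
      rw [hsum]
      simp [hw', hm']
    · let inj : (kerGM X' deg' g').M →ₗ[MvPolynomial V K]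
          (kerGM X (Sum.elim deg' deg'') (Sum.elim (fun b => i (g' b)) t)).M :=
        { toFun := fun w => ⟨Sum.elim w.1 0, by
            have := (mem_kerSub g' w.1).1 w.2
            rw [mem_kerSub, hsum]; simp [this]⟩
          map_add' := by
            intro a b; apply Subtype.ext; funext c
            rcases c with c | c
            · rfl
            · exact (add_zero _).symm
          map_smul' := by
            intro r b; apply Subtype.ext; funext c
            rcases c with c | c
            · rfl
            · exact (mul_zero _).symm }
      let prj : (kerGM X (Sum.elim deg' deg'') (Sum.elim (fun b => i (g' b)) t)).M
          →ₗ[MvPolynomial V K] (kerGM X'' deg'' g'').M :=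
        { toFun := fun w => ⟨fun b => w.1 (Sum.inr b), by
            have := (mem_kerSub _ w.1).1 w.2
            rw [hsum] at this
            have := congrArg p this
            rw [map_add, hpi, hpt, zero_add, map_zero] at this
            rwa [mem_kerSub]⟩
          map_add' := fun a b => rfl
          map_smul' := fun r b => rfl }
      have key : ∀ (w'' : (kerGM X'' deg'' g'').M), ∃ m', i m' = - ∑ b, w''.1 b • t b := by
        intro w''
        apply (hex _).1
        rw [map_neg, hpt, (mem_kerSub _ _).1 w''.2, neg_zero]
      refine ih inj prj ?_ ?_ ?_ ?_ ?_ ?_ h5' h5''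
      · intro a b hab
        apply Subtype.ext
        funext c
        exact congrFun (congrArg Subtype.val hab) (Sum.inl c)
      · intro m
        constructor
        · intro hm
          have hm' : ∀ b, m.1 (Sum.inr b) = 0 := fun b => congrFun (congrArg Subtype.val hm) b
          have h0 := (mem_kerSub _ m.1).1 m.2
          rw [hsum] at h0
          simp only [hm', zero_smul, Finset.sum_const_zero, add_zero] at h0
          refine ⟨⟨fun b => m.1 (Sum.inl b), (mem_kerSub _ _).2 (hi (by rw [h0, map_zero]))⟩, ?_⟩
          apply Subtype.ext; funext c
          rcases c with c | c
          · rfl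
          · exact (hm' c).symm
        · rintro ⟨w, rfl⟩
          rfl
      · intro w''
        obtain ⟨m', hm'⟩ := key w''
        obtain ⟨w', hw'⟩ := h3' m'
        refine ⟨⟨Sum.elim w' w''.1, ?_⟩, rfl⟩
        rw [mem_kerSub, hsum]
        simp [hw', hm']
      · intro j m
        constructor
        · intro h b
          exact h (Sum.inl b)
        · intro h b
          rcases b with b | b
          · exact h b
          · exact HH.zero _ _
      · intro j m h b
        exact h (Sum.inr b)
      · intro j w'' hw''
        obtain ⟨m', hm'⟩ := key w''
        obtain ⟨w', hh', hw'⟩ := h4' j m' (by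
          rw [← hgi, hm']; exact neg_mem (htm _ _ hw''))
        refine ⟨⟨Sum.elim w' w''.1, ?_⟩, ?_, rfl⟩
        · rw [mem_kerSub, hsum]
          simp [hw', hm']
        · intro b
          rcases b with b | b
          · exact hh' b
          · exact hw'' b

end Horseshoe
end EdgeIdealReg

namespace EdgeIdealReg
open scoped Classical

section Cone
variable {K V : Type} [Field K]

lemma HasRes.bot (d : ℕ) : HasRes 0 (idGM (⊥ : Ideal (MvPolynomial V K)) 0) d := by
  intro m
  exact Subtype.ext ((Submodule.mem_bot _).1 m.2)

lemma HasRes.top : HasRes 1 (idGM (⊤ : Ideal (MvPolynomial V K)) 0) 0 := by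
  refine ⟨Unit, inferInstance, fun _ => 0, fun _ => ⟨1, trivial⟩, fun _ => le_rfl,
    fun _ => Or.inr ⟨0, rfl, isHomogeneous_one _ _⟩, ?_, ?_, ?_⟩
  · intro m
    refine ⟨fun _ => m.1, Subtype.ext ?_⟩
    simp
  · intro j m hm
    refine ⟨fun _ => m.1, fun _ => hm, Subtype.ext ?_⟩
    simp
  · intro m
    have := congrArg Subtype.val ((mem_kerSub _ m.1).1 m.2)
    apply Subtype.ext
    funext b
    simpa using this

/-- The cone lemma. -/
lemma HasRes.cone {n d : ℕ} (I' A I : Ideal (MvPolynomial V K)) (x : V)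
    (hle : I' ≤ A) (hcol : ∀ f, X x * f ∈ I' → f ∈ I')
    (hI'I : I' ≤ I) (hxA : ∀ f ∈ A, X x * f ∈ I)
    (hdec : ∀ f ∈ I, ∃ a ∈ I', ∃ b ∈ A, f = a + X x * b)
    (hh' : ∀ f ∈ I', ∀ j, homogeneousComponent j f ∈ I')
    (hhA : ∀ f ∈ A, ∀ j, homogeneousComponent j f ∈ A)
    (h' : HasRes n (idGM I' 0) (d + 1)) (hA : HasRes n (idGM A 0) d) :
    HasRes (n + 2) (idGM I 0) (d + 1) := by
  have hprj : ∀ (I : Ideal (MvPolynomial V K)), (∀ f ∈ I, ∀ j, homogeneousComponent j f ∈ I) →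
      ∀ f ∈ I, ∀ j s, prj j s f ∈ I := by
    intro I h f hf j s
    unfold prj
    split_ifs
    · exact h f hf _
    · exact I.zero_mem
  have hsh : HasRes (n + 1) (idGM I' 1) (d + 1 + 1) := by
    refine HasRes.shift 1 (X := idGM I' 0) (Y := idGM I' 1) (LinearEquiv.refl _ _) ?_ ?_ h'.succ
    · intro j m
      exact ⟨fun h => HH.shift h, fun h => HH.unshift h⟩
    · intro j m hj hm
      exact Subtype.ext (HH.eq_zero hm hj)
  obtain ⟨B1, f1, deg1, g1, a1, b1, c1, e1, k1⟩ := h'.succ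
  obtain ⟨B2, f2, deg2, g2, a2, b2, c2, e2, k2⟩ := hA.succ
  have hX : ∀ j, HH (j + 1) j (X x : MvPolynomial V K) :=
    fun j => Or.inr ⟨1, rfl, isHomogeneous_X _ _⟩
  -- underlying sums
  have c1' : ∀ f ∈ I', ∃ w : B1 → MvPolynomial V K, ∑ b, w b * (g1 b).1 = f := by
    intro f hf
    obtain ⟨w, hw⟩ := c1 ⟨f, hf⟩
    exact ⟨w, by simpa using congrArg Subtype.val hw⟩
  have c2' : ∀ f ∈ A, ∃ w : B2 → MvPolynomial V K, ∑ b, w b * (g2 b).1 = f := by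
    intro f hf
    obtain ⟨w, hw⟩ := c2 ⟨f, hf⟩
    exact ⟨w, by simpa using congrArg Subtype.val hw⟩
  have e1' : ∀ j, ∀ f ∈ I', HH j 0 f → ∃ w : B1 → MvPolynomial V K,
      (∀ b, HH j (deg1 b) (w b)) ∧ ∑ b, w b * (g1 b).1 = f := by
    intro j f hf hh
    obtain ⟨w, hw1, hw⟩ := e1 j ⟨f, hf⟩ hh
    exact ⟨w, hw1, by simpa using congrArg Subtype.val hw⟩
  have e2' : ∀ j, ∀ f ∈ A, HH j 0 f → ∃ w : B2 → MvPolynomial V K,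
      (∀ b, HH j (deg2 b) (w b)) ∧ ∑ b, w b * (g2 b).1 = f := by
    intro j f hf hh
    obtain ⟨w, hw1, hw⟩ := e2 j ⟨f, hf⟩ hh
    exact ⟨w, hw1, by simpa using congrArg Subtype.val hw⟩
  -- version with shift
  have e2'' : ∀ j, ∀ f ∈ A, HH j 1 f → ∃ w : B2 → MvPolynomial V K,
      (∀ b, HH j (deg2 b + 1) (w b)) ∧ ∑ b, w b * (g2 b).1 = f := by
    intro j f hf hh
    rcases j with _ | j
    · refine ⟨0, fun b => HH.zero _ _, ?_⟩
      rw [hh.eq_zero (by omega)]; simp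
    · obtain ⟨w, h1, h2⟩ := e2' j f hf hh.unshift
      exact ⟨w, fun b => (h1 b).shift, h2⟩
  have hs1 : ∀ w : B1 → MvPolynomial V K, ∑ b, w b * (g1 b).1 ∈ I' := fun w =>
    _root_.sum_mem fun b _ => I'.mul_mem_left _ (g1 b).2
  have hs2 : ∀ w : B2 → MvPolynomial V K, ∑ b, w b * (g2 b).1 ∈ A := fun w =>
    _root_.sum_mem fun b _ => A.mul_mem_left _ (g2 b).2
  let g : B1 ⊕ B2 → I := Sum.elim (fun b => ⟨(g1 b).1, hI'I (g1 b).2⟩)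
    (fun b => ⟨X x * (g2 b).1, hxA _ (g2 b).2⟩)
  have hg : ∀ w : B1 ⊕ B2 → MvPolynomial V K, (∑ b, w b • g b : I).1
      = ∑ b, w (Sum.inl b) * (g1 b).1 + X x * ∑ b, w (Sum.inr b) * (g2 b).1 := by
    intro w
    rw [Fintype.sum_sum_type, Finset.mul_sum]
    simp [g, mul_left_comm]
  have hker : ∀ w : B1 ⊕ B2 → MvPolynomial V K, w ∈ kerSub g ↔
      ∑ b, w (Sum.inl b) * (g1 b).1 + X x * ∑ b, w (Sum.inr b) * (g2 b).1 = 0 := by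
    intro w
    rw [mem_kerSub, ← hg, Subtype.ext_iff]; rfl
  have hk1 : ∀ w : B1 → MvPolynomial V K, w ∈ kerSub g1 ↔ ∑ b, w b * (g1 b).1 = 0 := by
    intro w
    rw [mem_kerSub, Subtype.ext_iff]
    simp
  have hk2 : ∀ w : B2 → MvPolynomial V K, w ∈ kerSub g2 ↔ ∑ b, w b * (g2 b).1 = 0 := by
    intro w
    rw [mem_kerSub, Subtype.ext_iff]
    simp
  -- the module of `w2` with `∑ w2 g2 ∈ I'`
  let Q : Submodule (MvPolynomial V K) (B2 → MvPolynomial V K) :=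
    { carrier := {w | ∑ b, w b * (g2 b).1 ∈ I'}
      zero_mem' := by simp
      add_mem' := by
        intro a b ha hb
        simp only [Set.mem_setOf_eq, Pi.add_apply, add_mul, Finset.sum_add_distrib] at *
        exact I'.add_mem ha hb
      smul_mem' := by
        intro r a ha
        simp only [Set.mem_setOf_eq, Pi.smul_apply, smul_eq_mul, mul_assoc,
          ← Finset.mul_sum] at *
        exact I'.mul_mem_left _ ha }
  have hQ : ∀ w, w ∈ Q ↔ ∑ b, w b * (g2 b).1 ∈ I' := fun w => Iff.rfl
  have hk2s : HasRes n (subF (fun b => deg2 b + 1) (kerSub (K := K) (V := V) g2)) (d + 1 + 1) := by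
    refine HasRes.shift 1 (X := kerGM _ deg2 g2) (LinearEquiv.refl _ _) ?_ ?_ k2
    · intro j m
      exact ⟨fun h b => HH.shift (h b), fun h b => HH.unshift (h b)⟩
    · intro j m hj hm
      apply Subtype.ext
      funext b
      exact (hm b).eq_zero (show j < deg2 b + 1 by omega)
  have hQres : HasRes (n + 1) (subF (fun b => deg2 b + 1) Q) (d + 1 + 1) := by
    refine HasRes.horseshoe (X' := subF (fun b => deg2 b + 1) (kerSub (K := K) (V := V) g2))
      (X'' := idGM I' 1) 
      (Submodule.inclusion (fun w hw => by
        rw [hQ, (hk2 w).1 hw]; exact I'.zero_mem))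
      { toFun := fun w => ⟨∑ b, w.1 b * (g2 b).1, w.2⟩
        map_add' := fun a b => Subtype.ext (by simp [add_mul, Finset.sum_add_distrib])
        map_smul' := fun a b => Subtype.ext (by simp [mul_assoc, Finset.mul_sum]) }
      (Submodule.inclusion_injective _) ?_ ?_ ?_ ?_ ?_ hk2s.succ hsh
    · intro m
      constructor
      · intro hm
        exact ⟨⟨m.1, (hk2 _).2 (congrArg Subtype.val hm)⟩, rfl⟩
      · rintro ⟨w, rfl⟩
        exact Subtype.ext ((hk2 _).1 w.2)
    · intro y
      obtain ⟨w, hw⟩ := c2' y.1 (hle y.2)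
      exact ⟨⟨w, by rw [hQ, hw]; exact y.2⟩, Subtype.ext hw⟩
    · intro j m; exact Iff.rfl
    · intro j m hm
      refine HH.sum fun b _ => HH.mul (hm b) ?_
      exact HH.shift (b2 b)
    · intro j y hy
      obtain ⟨w, hw1, hw⟩ := e2'' j y.1 (hle y.2) hy
      exact ⟨⟨w, by rw [hQ, hw]; exact y.2⟩, hw1, Subtype.ext hw⟩
  refine ⟨B1 ⊕ B2, inferInstance, Sum.elim deg1 (fun b => deg2 b + 1), g, ?_, ?_, ?_, ?_, ?_⟩
  · rintro (b | b)
    · exact a1 b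
    · exact Nat.succ_le_succ (a2 b)
  · rintro (b | b)
    · exact b1 b
    · exact HH.mul (hX _) (b2 b)
  · intro m
    obtain ⟨a, ha, b, hb, hab⟩ := hdec m.1 m.2
    obtain ⟨w1, hw1⟩ := c1' a ha
    obtain ⟨w2, hw2⟩ := c2' b hb
    refine ⟨Sum.elim w1 w2, Subtype.ext ?_⟩
    rw [hg, hab, ← hw1, ← hw2]
    rfl
  · intro j m hm
    obtain ⟨a, ha, b, hb, hab⟩ := hdec m.1 m.2
    obtain ⟨w1, hh1, hw1⟩ := e1' j _ (hprj _ hh' a ha j 0) (prj_HH _ _ _)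
    obtain ⟨w2, hh2, hw2⟩ := e2'' j _ (hprj _ hhA b hb j 1) (prj_HH _ _ _)
    refine ⟨Sum.elim w1 w2, ?_, Subtype.ext ?_⟩
    · rintro (b | b)
      · exact hh1 b
      · exact hh2 b
    rw [hg]
    simp only [Sum.elim_inl, Sum.elim_inr]
    rw [hw1, hw2, ← prj_mul (hX 0), ← map_add, ← hab]
    exact prj_eq_self hm
  · refine HasRes.horseshoe (X' := kerGM _ deg1 g1) (X'' := subF (fun b => deg2 b + 1) Q)
      { toFun := fun w => ⟨Sum.elim w.1 0, by
          rw [hker]; simpa using (hk1 _).1 w.2⟩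
        map_add' := by
            intro a b; apply Subtype.ext; funext c
            rcases c with c | c
            · rfl
            · exact (add_zero _).symm
        map_smul' := by
            intro r b; apply Subtype.ext; funext c
            rcases c with c | c
            · rfl
            · exact (mul_zero _).symm }
      { toFun := fun w => ⟨fun b => w.1 (Sum.inr b), by
          rw [hQ]
          apply hcol
          have := (hker _).1 w.2
          rw [add_comm] at this
          rw [eq_neg_of_add_eq_zero_left this]
          exact I'.neg_mem (hs1 _)⟩
        map_add' := fun a b => rfl
        map_smul' := fun a b => rfl } ?_ ?_ ?_ ?_ ?_ ?_ k1.succ hQres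
    · intro a b hab
      apply Subtype.ext
      funext c
      exact congrFun (congrArg Subtype.val hab) (Sum.inl c)
    · intro m
      constructor
      · intro hm
        have hm' : ∀ b, m.1 (Sum.inr b) = 0 := fun b => congrFun (congrArg Subtype.val hm) b
        have h0 := (hker m.1).1 m.2
        simp only [hm', zero_mul, Finset.sum_const_zero, add_zero, mul_zero] at h0
        refine ⟨⟨fun b => m.1 (Sum.inl b), (hk1 _).2 h0⟩, ?_⟩
        apply Subtype.ext; funext c
        rcases c with c | c
        · rfl
        · exact (hm' c).symm
      · rintro ⟨w, rfl⟩
        rfl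
    · intro w
      obtain ⟨w1, hw1⟩ := c1' (- (X x * ∑ b, w.1 b * (g2 b).1))
        (I'.neg_mem (I'.mul_mem_left _ w.2))
      refine ⟨⟨Sum.elim w1 w.1, ?_⟩, rfl⟩
      rw [hker]
      simp only [Sum.elim_inl, Sum.elim_inr]
      rw [hw1]; ring
    · intro j m
      constructor
      · intro h b
        exact h (Sum.inl b)
      · intro h b
        rcases b with b | b
        · exact h b
        · exact HH.zero _ _
    · intro j m h b
      exact h (Sum.inr b)
    · intro j w hw
      obtain ⟨w1, hh1, hw1⟩ := e1' j (- (X x * ∑ b, w.1 b * (g2 b).1))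
        (I'.neg_mem (I'.mul_mem_left _ w.2)) (by
          rw [Finset.mul_sum]
          refine (HH.sum fun b _ => ?_).neg
          rw [mul_left_comm]
          exact HH.mul (hw b) (HH.mul (hX _) (b2 b)))
      refine ⟨⟨Sum.elim w1 w.1, ?_⟩, ?_, rfl⟩
      · rw [hker]
        simp only [Sum.elim_inl, Sum.elim_inr]
        rw [hw1]; ring
      · intro b
        rcases b with b | b
        · exact hh1 b
        · exact hw b

end Cone
end EdgeIdealReg

namespace EdgeIdealReg
open scoped Classical

section Conv
variable {K V : Type} [Field K]

/-- Raw data of a complex of graded free modules. -/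
structure Pre (K V : Type) [Field K] where
  rank : ℕ → ℕ
  deg : (i : ℕ) → Fin (rank i) → ℕ
  mat : (i : ℕ) → Matrix (Fin (rank i)) (Fin (rank (i + 1))) (MvPolynomial V K)
  homog : ∀ i k j, HH (deg (i + 1) j) (deg i k) (mat i k j)
  isExact : ∀ i, LinearMap.ker (Matrix.mulVecLin (mat i)) =
    LinearMap.range (Matrix.mulVecLin (mat (i + 1)))

/-- Adding a new module in front. -/
def Pre.cons (P : Pre K V) (r : ℕ) (deg0 : Fin r → ℕ)
    (m0 : Matrix (Fin r) (Fin (P.rank 0)) (MvPolynomial V K))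
    (hh : ∀ k j, HH (P.deg 0 j) (deg0 k) (m0 k j))
    (hex : LinearMap.ker (Matrix.mulVecLin m0) = LinearMap.range (Matrix.mulVecLin (P.mat 0))) :
    Pre K V where
  rank := fun i => Nat.casesOn i r P.rank
  deg := fun i => match i with
    | 0 => deg0
    | i + 1 => P.deg i
  mat := fun i => match i with
    | 0 => m0
    | i + 1 => P.mat i
  homog := fun i => match i with
    | 0 => hh
    | i + 1 => P.homog i
  isExact := fun i => match i with
    | 0 => hex
    | i + 1 => P.isExact i

lemma HasRes.conv {n : ℕ} : ∀ {X : GM K V} {d : ℕ}, HasRes n X d →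
    ∃ (P : Pre K V) (g : Fin (P.rank 0) → X.M), (∀ i k, P.deg i k ≤ d + i) ∧
      (∀ k, g k ∈ X.gr (P.deg 0 k)) ∧
      (∀ m : X.M, ∃ w : Fin (P.rank 0) → MvPolynomial V K, ∑ k, w k • g k = m) ∧
      (∀ w : Fin (P.rank 0) → MvPolynomial V K,
        ∑ k, w k • g k = 0 ↔ w ∈ LinearMap.range (Matrix.mulVecLin (P.mat 0))) := by
  induction n with
  | zero =>
    intro X d h
    refine ⟨⟨fun _ => 0, fun _ _ => 0, fun _ => 0, fun _ _ _ => HH.zero _ _, ?_⟩, fun _ => 0,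
      fun i k => k.elim0, fun k => k.elim0, fun m => ⟨0, by simp [h m]⟩, ?_⟩
    · intro i
      ext w
      have : w = 0 := by funext k; exact k.elim0
      subst this
      exact ⟨fun _ => Submodule.zero_mem _, fun _ => Submodule.zero_mem _⟩
    · intro w
      have : w = 0 := by funext k; exact k.elim0
      subst this
      exact ⟨fun _ => Submodule.zero_mem _, fun _ => by simp⟩
  | succ n ih =>
    rintro X d ⟨B, fB, deg, g, h1, h2, h3, h4, h5⟩
    obtain ⟨P, g', p1, p2, p3, p4⟩ := ih h5
    let σ : Fin (Fintype.card B) ≃ B := (Fintype.equivFin B).symm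
    let m0 : Matrix (Fin (Fintype.card B)) (Fin (P.rank 0)) (MvPolynomial V K) :=
      fun k j => (g' j).1 (σ k)
    have hm0 : ∀ (w : Fin (P.rank 0) → MvPolynomial V K) (k),
        m0.mulVec w k = (∑ j, w j • g' j : kerSub g).1 (σ k) := by
      intro w k
      simp [m0, Matrix.mulVec, dotProduct, Finset.sum_apply, mul_comm]
    have hsum : ∀ w : Fin (Fintype.card B) → MvPolynomial V K,
        ∑ k, w k • g (σ k) = ∑ b, w (σ.symm b) • g b := by
      intro w
      rw [← Equiv.sum_comp σ]
      simp
    refine ⟨P.cons (Fintype.card B) (fun k => deg (σ k)) m0 (fun k j => p2 j (σ k)) ?_,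
      fun k => g (σ k), ?_, fun k => h2 _, ?_, ?_⟩
    · ext w
      rw [← p4, LinearMap.mem_ker, Matrix.mulVecLin_apply,
        Subtype.ext_iff]
      constructor
      · intro h
        funext b
        have := congrFun h (σ.symm b)
        rw [hm0, Equiv.apply_symm_apply] at this
        exact this
      · intro h
        funext k
        rw [hm0, h]; rfl
    · rintro (_ | i) k
      · exact h1 _
      · have := p1 i k
        show P.deg i k ≤ d + (i + 1)
        omega
    · intro m
      obtain ⟨w, hw⟩ := h3 m
      refine ⟨fun k => w (σ k), ?_⟩
      rw [← hw]
      exact Equiv.sum_comp σ (fun b => w b • g b)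
    · suffices H : ∀ w : Fin (Fintype.card B) → MvPolynomial V K,
          ∑ k, w k • g (σ k) = 0 ↔ w ∈ LinearMap.range (Matrix.mulVecLin m0) from H
      intro w
      rw [hsum]
      rw [← mem_kerSub g (fun b => w (σ.symm b))]
      constructor
      · intro h
        obtain ⟨y, hy⟩ := p3 ⟨_, h⟩
        refine ⟨y, ?_⟩
        funext k
        rw [Matrix.mulVecLin_apply, hm0, hy]
        simp
      · rintro ⟨y, rfl⟩
        have : (fun b => Matrix.mulVecLin m0 y (σ.symm b)) = (∑ j, y j • g' j : kerSub g).1 := by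
          funext b
          rw [Matrix.mulVecLin_apply, hm0, Equiv.apply_symm_apply]
        rw [this]
        exact (∑ j, y j • g' j : kerSub g).2

lemma HasRes.toResolution {n d : ℕ} {I : Ideal (MvPolynomial V K)}
    (h : HasRes n (idGM I 0) (d + 1)) :
    ∃ F : GradedFreeResolution I, ∀ i (k : Fin (F.rank i)), (F.deg i k : ℤ) ≤ (d : ℤ) + i := by
  obtain ⟨P, g, p1, p2, p3, p4⟩ := h.conv
  let m0 : Matrix (Fin 1) (Fin (P.rank 0)) (MvPolynomial V K) := fun _ j => (g j).1
  have hm0 : ∀ (w : Fin (P.rank 0) → MvPolynomial V K) (k),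
        m0.mulVec w k = (∑ j, w j • g j : I).1 := by
      intro w k
      simp [m0, Matrix.mulVec, dotProduct, mul_comm]
  let Q := P.cons 1 (fun _ => 0) m0 (fun k j => p2 j) (by
    ext w
    rw [← p4, LinearMap.mem_ker, Matrix.mulVecLin_apply,
        Subtype.ext_iff]
    constructor
    · intro h
      have := congrFun h 0
      rw [hm0] at this
      exact this
    · intro h
      funext k
      rw [hm0, h]; rfl)
  refine ⟨⟨Q.rank, Q.deg, rfl, fun k => rfl, Q.mat, Q.homog, ?_, Q.isExact⟩, ?_⟩
  · intro f
    show f ∈ I ↔ (fun _ => f) ∈ LinearMap.range (Matrix.mulVecLin m0)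
    constructor
    · intro hf
      obtain ⟨w, hw⟩ := p3 ⟨f, hf⟩
      refine ⟨w, ?_⟩
      funext k
      rw [Matrix.mulVecLin_apply, hm0, hw]
    · rintro ⟨w, hw⟩
      have := congrFun hw 0
      rw [Matrix.mulVecLin_apply, hm0] at this
      rw [← this]
      exact (∑ j, w j • g j : I).2
  · rintro (_ | i) k
    · show ((0 : ℕ) : ℤ) ≤ _
      positivity
    · have := p1 i k
      show ((P.deg i k : ℕ) : ℤ) ≤ (d : ℤ) + ((i + 1 : ℕ) : ℤ)
      push_cast
      omega

end Conv
end EdgeIdealReg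

namespace EdgeIdealReg
open scoped Classical

section Mono
variable {K V : Type} [Field K]

/-- The monomial ideal of all polynomials whose monomials satisfy `P`. -/
def MI (K : Type) [Field K] {V : Type} (P : (V →₀ ℕ) → Prop) (hP : ∀ m m', P m → P (m' + m)) :
    Ideal (MvPolynomial V K) where
  carrier := {f | ∀ m ∈ f.support, P m}
  zero_mem' := by intro m hm; simp at hm
  add_mem' := by
    intro a b ha hb m hm
    rcases Finset.mem_union.mp (support_add hm) with h | h
    · exact ha m h
    · exact hb m h
  smul_mem' := by
    intro c f hf m hm
    have := support_mul c f hm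
    obtain ⟨u, hu, v, hv, rfl⟩ := Finset.mem_add.mp this
    exact hP _ _ (hf v hv)

lemma mem_MI {P : (V →₀ ℕ) → Prop} {hP} {f : MvPolynomial V K} :
    f ∈ MI K P hP ↔ ∀ m ∈ f.support, P m := Iff.rfl

lemma MI_hc {P : (V →₀ ℕ) → Prop} {hP} (f : MvPolynomial V K) (hf : f ∈ MI K P hP) (j : ℕ) :
    homogeneousComponent j f ∈ MI K P hP := by
  intro m hm
  apply hf
  rw [mem_support_iff, coeff_homogeneousComponent] at hm
  rw [mem_support_iff]
  intro h
  simp [h] at hm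

lemma monomial_mem_MI {P : (V →₀ ℕ) → Prop} {hP} {m : V →₀ ℕ} (h : P m) (c : K) :
    monomial m c ∈ MI K P hP := by
  intro m' hm'
  have := support_monomial_subset hm'
  rw [Finset.mem_singleton] at this
  rw [this]; exact h

lemma MI_cone {n d : ℕ} {P' A P : (V →₀ ℕ) → Prop} {hP' hA hP} (x : V)
    (h1 : ∀ m, P' m → A m) (h2 : ∀ m, P' (Finsupp.single x 1 + m) → P' m) (h3 : ∀ m, P' m → P m)
    (h4 : ∀ m, A m → P (Finsupp.single x 1 + m))
    (h5 : ∀ m, P m → P' m ∨ ∃ m', m = Finsupp.single x 1 + m' ∧ A m')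
    (r' : HasRes n (idGM (MI K P' hP') 0) (d + 1)) (rA : HasRes n (idGM (MI K A hA) 0) d) :
    HasRes (n + 2) (idGM (MI K P hP) 0) (d + 1) := by
  refine HasRes.cone (MI K P' hP') (MI K A hA) (MI K P hP) x ?_ ?_ ?_ ?_ ?_ ?_ ?_ r' rA
  · intro f hf m hm; exact h1 m (hf m hm)
  · intro f hf m hm
    apply h2
    apply hf
    rw [mem_support_iff, coeff_X_mul]
    exact mem_support_iff.mp hm
  · intro f hf m hm; exact h3 m (hf m hm)
  · intro f hf m hm
    rw [mem_support_iff, coeff_X_mul'] at hm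
    split_ifs at hm with hx
    · have : m = Finsupp.single x 1 + (m - Finsupp.single x 1) := by
        rw [add_tsub_cancel_of_le]
        rw [Finsupp.single_le_iff]
        exact Nat.one_le_iff_ne_zero.mpr (Finsupp.mem_support_iff.mp hx)
      rw [this]
      exact h4 _ (hf _ (mem_support_iff.mpr hm))
    · exact absurd rfl hm
  · intro f hf
    rw [← support_sum_monomial_coeff f]
    have : ∀ t : Finset (V →₀ ℕ), (∀ m ∈ t, P m) → ∃ a ∈ MI K P' hP', ∃ b ∈ MI K A hA,
        ∑ v ∈ t, monomial v (coeff v f) = a + X x * b := by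
      intro t
      induction t using Finset.induction_on with
      | empty => intro _; exact ⟨0, zero_mem _, 0, zero_mem _, by simp⟩
      | insert m t hmt ih =>
        intro ht
        obtain ⟨a, ha, b, hb, hab⟩ := ih (fun m hm => ht m (Finset.mem_insert_of_mem hm))
        rw [Finset.sum_insert hmt, hab]
        rcases h5 m (ht m (Finset.mem_insert_self _ _)) with h | ⟨m', rfl, h⟩
        · exact ⟨_, add_mem (monomial_mem_MI h (coeff m f)) ha, b, hb, by ring⟩
        · refine ⟨a, ha, _, add_mem (monomial_mem_MI h (coeff (Finsupp.single x 1 + m') f)) hb, ?_⟩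
          rw [mul_add, X, monomial_mul, one_mul]
          ring
    exact this _ hf
  · intro f hf j; exact MI_hc f hf j
  · intro f hf j; exact MI_hc f hf j

variable (G : SimpleGraph V)

/-- Exponent predicate. -/
def PP (s Y : Finset V) (m : V →₀ ℕ) : Prop :=
  (∃ u v, G.Adj u v ∧ u ∈ s ∧ v ∈ s ∧ m u ≠ 0 ∧ m v ≠ 0) ∨ ∃ y ∈ Y, m y ≠ 0

lemma PP_up (s Y : Finset V) (m m' : V →₀ ℕ) (h : PP G s Y m) : PP G s Y (m' + m) := by
  rcases h with ⟨u, v, h1, h2, h3, h4, h5⟩ | ⟨y, h1, h2⟩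
  · left
    exact ⟨u, v, h1, h2, h3, by simp [h4], by simp [h5]⟩
  · right
    exact ⟨y, h1, by simp [h2]⟩

abbrev JJ (K : Type) [Field K] (s Y : Finset V) : Ideal (MvPolynomial V K) :=
  MI K (PP G s Y) (PP_up G s Y)

def Reg (K : Type) [Field K] (s : Finset V) (d : ℕ) : Prop :=
  ∀ Y : Finset V, Disjoint Y s → ∃ n, HasRes n (idGM (JJ G K s Y) 0) (d + 1)

lemma Reg.mono {s : Finset V} {d d' : ℕ} (h : d ≤ d') (hr : Reg G K s d) : Reg G K s d' := by
  intro Y hY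
  obtain ⟨n, hn⟩ := hr Y hY
  exact ⟨n, hn.mono (by omega)⟩

lemma single_add_ne {x u : V} {m : V →₀ ℕ} (h : u ≠ x) :
    (Finsupp.single x 1 + m : V →₀ ℕ) u = m u := by
  simp [Finsupp.single_apply, Ne.symm h]

lemma Reg.zero {s : Finset V} (hs : ∀ u ∈ s, ∀ v ∈ s, ¬ G.Adj u v) : Reg G K s 0 := by
  intro Y
  induction Y using Finset.induction_on with
  | empty =>
    intro _
    refine ⟨0, ?_⟩
    have : JJ G K s ∅ = ⊥ := by
      rw [eq_bot_iff]
      intro f hf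
      rw [Ideal.mem_bot]
      by_contra hne
      obtain ⟨m, hm⟩ := (support_nonempty (p := f)).mpr hne
      rcases hf m hm with ⟨u, v, h1, h2, h3, h4, h5⟩ | ⟨y, h1, h2⟩
      · exact hs u h2 v h3 h1
      · simp at h1
    rw [this]
    exact HasRes.bot _
  | insert y Y hy ih =>
    intro hd
    obtain ⟨n, hn⟩ := ih (hd.mono_left (Finset.subset_insert _ _))
    have ht : (MI K (fun _ : V →₀ ℕ => True) (fun _ _ _ => trivial)) = (⊤ : Ideal (MvPolynomial V K)) := by
      rw [eq_top_iff]
      intro f _ m _; trivial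
    have hys : y ∉ s := Finset.disjoint_left.mp hd (Finset.mem_insert_self _ _)
    refine ⟨max n 1 + 2, MI_cone (P' := PP G s Y) (hP' := PP_up G s Y) (A := fun _ => True)
      (hA := fun _ _ _ => trivial) y ?_ ?_ ?_ ?_ ?_
      (hn.mono_len (le_max_left _ _)) ?_⟩
    · intro m _; trivial
    · rintro m (⟨u, v, h1, h2, h3, h4, h5⟩ | ⟨z, h1, h2⟩)
      · exact absurd h1 (hs u h2 v h3)
      · right
        refine ⟨z, h1, ?_⟩
        rwa [single_add_ne] at h2
        rintro rfl; exact hy h1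
    · rintro m (h | ⟨z, h1, h2⟩)
      · exact Or.inl h
      · exact Or.inr ⟨z, Finset.mem_insert_of_mem h1, h2⟩
    · intro m _
      exact Or.inr ⟨y, Finset.mem_insert_self _ _, by simp⟩
    · rintro m (h | ⟨z, h1, h2⟩)
      · exact Or.inl (Or.inl h)
      · rcases Finset.mem_insert.mp h1 with rfl | h1
        · right
          refine ⟨m - Finsupp.single z 1, ?_, trivial⟩
          rw [add_tsub_cancel_of_le]
          rw [Finsupp.single_le_iff]
          omega
        · exact Or.inl (Or.inr ⟨z, h1, h2⟩)
    · rw [ht]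
      exact (HasRes.top.mono_len (le_max_right _ _))

lemma Reg.step {s : Finset V} {d : ℕ} {x : V} (hx : x ∈ s) (h1 : Reg G K (s.erase x) (d + 1))
    (h2 : Reg G K (s.filter (fun v => v ≠ x ∧ ¬ G.Adj x v)) d) : Reg G K s (d + 1) := by
  intro Y hY
  obtain ⟨n1, r1⟩ := h1 Y (hY.mono_right (Finset.erase_subset _ _))
  obtain ⟨n2, r2⟩ := h2 (Y ∪ s.filter (fun v => G.Adj x v)) (by
    rw [Finset.disjoint_left]
    intro a ha hb
    rw [Finset.mem_filter] at hb
    rcases Finset.mem_union.mp ha with h | h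
    · exact Finset.disjoint_left.mp hY h hb.1
    · exact hb.2.2 (Finset.mem_filter.mp h).2)
  have hxY : ∀ y ∈ Y, y ≠ x := fun y hy h => Finset.disjoint_left.mp hY hy (h ▸ hx)
  refine ⟨max n1 n2 + 2, MI_cone x ?_ ?_ ?_ ?_ ?_
      (r1.mono_len (le_max_left _ _)) (r2.mono_len (le_max_right _ _))⟩
  · rintro m (⟨u, v, a1, a2, a3, a4, a5⟩ | ⟨y, a1, a2⟩)
    · rw [Finset.mem_erase] at a2 a3
      by_cases hu : G.Adj x u
      · exact Or.inr ⟨u, by simp [hu, a2], a4⟩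
      by_cases hv : G.Adj x v
      · exact Or.inr ⟨v, by simp [hv, a3], a5⟩
      exact Or.inl ⟨u, v, a1, by simp [hu, a2], by simp [hv, a3], a4, a5⟩
    · exact Or.inr ⟨y, by simp [a1], a2⟩
  · rintro m (⟨u, v, a1, a2, a3, a4, a5⟩ | ⟨y, a1, a2⟩)
    · rw [single_add_ne (Finset.ne_of_mem_erase a2)] at a4
      rw [single_add_ne (Finset.ne_of_mem_erase a3)] at a5
      exact Or.inl ⟨u, v, a1, a2, a3, a4, a5⟩
    · rw [single_add_ne (hxY y a1)] at a2
      exact Or.inr ⟨y, a1, a2⟩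
  · rintro m (⟨u, v, a1, a2, a3, a4, a5⟩ | ⟨y, a1, a2⟩)
    · exact Or.inl ⟨u, v, a1, Finset.mem_of_mem_erase a2, Finset.mem_of_mem_erase a3, a4, a5⟩
    · exact Or.inr ⟨y, a1, a2⟩
  · rintro m (⟨u, v, a1, a2, a3, a4, a5⟩ | ⟨y, a1, a2⟩)
    · exact Or.inl ⟨u, v, a1, (Finset.mem_filter.mp a2).1, (Finset.mem_filter.mp a3).1,
        by simp [a4], by simp [a5]⟩
    · rcases Finset.mem_union.mp a1 with h | h
      · exact Or.inr ⟨y, h, by simp [a2]⟩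
      · rw [Finset.mem_filter] at h
        exact Or.inl ⟨x, y, h.2, hx, h.1, by simp, by simp [a2]⟩
  · have key : ∀ m : V →₀ ℕ, ∀ v, v ∈ s → G.Adj x v → m x ≠ 0 → m v ≠ 0 →
        ∃ m', m = Finsupp.single x 1 + m' ∧ PP G (s.filter (fun v => v ≠ x ∧ ¬ G.Adj x v))
          (Y ∪ s.filter (fun v => G.Adj x v)) m' := by
      intro m v hv hadj hm1 hm2
      have e : m = Finsupp.single x 1 + (m - Finsupp.single x 1) := by
        rw [add_tsub_cancel_of_le]
        rw [Finsupp.single_le_iff]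
        omega
      refine ⟨m - Finsupp.single x 1, e, Or.inr ⟨v, by simp [hv, hadj], ?_⟩⟩
      rw [e, single_add_ne hadj.ne'] at hm2
      exact hm2
    rintro m (⟨u, v, a1, a2, a3, a4, a5⟩ | ⟨y, a1, a2⟩)
    · by_cases hu : u = x
      · subst hu; exact Or.inr (key m v a3 a1 a4 a5)
      by_cases hv : v = x
      · subst hv; exact Or.inr (key m u a2 a1.symm a5 a4)
      exact Or.inl (Or.inl ⟨u, v, a1, by simp [hu, a2], by simp [hv, a3], a4, a5⟩)
    · exact Or.inl (Or.inr ⟨y, a1, a2⟩)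

lemma edgeIdeal_eq [Fintype V] : edgeIdeal K G = JJ G K Finset.univ ∅ := by
  apply le_antisymm
  · rw [edgeIdeal, Ideal.span_le]
    rintro p ⟨u, v, h, rfl⟩
    rw [X, X, monomial_mul]
    apply monomial_mem_MI
    exact Or.inl ⟨u, v, h, Finset.mem_univ _, Finset.mem_univ _, by simp, by simp⟩
  · intro f hf
    rw [← support_sum_monomial_coeff f]
    refine sum_mem fun m hm => ?_
    rcases hf m hm with ⟨u, v, a1, a2, a3, a4, a5⟩ | ⟨y, a1, a2⟩
    · have : monomial m (coeff m f) =
        monomial (m - (Finsupp.single u 1 + Finsupp.single v 1)) (coeff m f) * (X u * X v) := by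
        rw [X, X, monomial_mul, monomial_mul, tsub_add_cancel_of_le]
        · simp
        · intro w
          have := a1.ne
          by_cases hu : w = u
          · subst hu
            simp [Finsupp.single_apply, this.symm]; omega
          · by_cases hv : w = v
            · subst hv
              simp [Finsupp.single_apply, this]; omega
            · simp [Finsupp.single_apply, Ne.symm hu, Ne.symm hv]
      rw [this]
      exact Ideal.mul_mem_left _ _ (Ideal.subset_span ⟨u, v, a1, rfl⟩)
    · simp at a1

end Mono
end EdgeIdealReg

namespace EdgeIdealReg
open scoped Classical

section GraphLemmas
variable {W : Type} [Fintype W]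

lemma acyc_card [Nonempty W] {Q : SimpleGraph W} [Fintype Q.edgeSet] (h : Q.IsAcyclic) :
    Q.edgeFinset.card + 1 ≤ Fintype.card W := by
  obtain ⟨T, hT, hmax⟩ := SimpleGraph.exists_maximal_isAcyclic_of_le_isAcyclic (le_top : Q ≤ ⊤) h
  have htree : T.IsTree := by
    apply SimpleGraph.maximal_isAcyclic_iff_isTree.mp
    constructor
    · exact hmax.1.2
    · intro T' hT' hle
      exact hmax.2 ⟨le_top, hT'⟩ hle
  rw [← htree.card_edgeFinset]
  have := Finset.card_le_card (SimpleGraph.edgeFinset_mono hT)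
  omega

lemma exists_cycle_of_deg [Nonempty W] {Q : SimpleGraph W} (h : ∀ v, 2 ≤ Q.degree v) :
    ∃ (v : W) (c : Q.Walk v v), c.IsCycle := by
  by_contra hne
  push Not at hne
  have hac : Q.IsAcyclic := fun v c hc => hne v c hc
  have h1 := acyc_card hac
  have h2 := Q.sum_degrees_eq_twice_card_edges
  have h3 : ∑ v : W, 2 ≤ ∑ v, Q.degree v := Finset.sum_le_sum fun v _ => h v
  simp at h3
  omega

lemma unique_cycle [Nonempty W] {Q : SimpleGraph W} (h : ∀ v, 2 ≤ Q.degree v)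
    (hu : ∀ (v : W) (c : Q.Walk v v) (w : W) (c' : Q.Walk w w), c.IsCycle → c'.IsCycle →
      ∀ e ∈ c.edges, e ∈ c'.edges) :
    ∃ (v : W) (c : Q.Walk v v), c.IsCycle ∧ ∀ x y, Q.Adj x y → s(x, y) ∈ c.edges := by
  obtain ⟨v, c, hc⟩ := exists_cycle_of_deg h
  refine ⟨v, c, hc, ?_⟩
  have hcard : Q.edgeFinset.card ≤ Fintype.card W := by
    obtain ⟨e, he⟩ : ∃ e, e ∈ c.edges := by
      have := hc.three_le_length
      rw [← SimpleGraph.Walk.length_edges] at this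
      exact List.exists_mem_of_length_pos (by omega)
    have hac : (Q.deleteEdges {e}).IsAcyclic := by
      intro w c' hc'
      have hle := Q.deleteEdges_le {e}
      have := hu v c w (c'.mapLe hle) hc (hc'.mapLe hle) e he
      rw [SimpleGraph.Walk.edges_mapLe_eq_edges] at this
      have := c'.edges_subset_edgeSet this
      simp [SimpleGraph.edgeSet_deleteEdges] at this
    have h1 := acyc_card hac
    have h2 : Q.edgeFinset ⊆ insert e (Q.deleteEdges {e}).edgeFinset := by
      intro f hf
      rw [Finset.mem_insert]
      by_cases hfe : f = e
      · exact Or.inl hfe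
      · right
        rw [SimpleGraph.mem_edgeFinset] at hf ⊢
        simp [SimpleGraph.edgeSet_deleteEdges, hf, hfe]
    have := Finset.card_le_card h2
    have := Finset.card_insert_le e (Q.deleteEdges {e}).edgeFinset
    omega
  have hdeg : ∀ v, Q.degree v = 2 := by
    have h2 := Q.sum_degrees_eq_twice_card_edges
    have h3 : ∑ v : W, 2 = ∑ v, Q.degree v := by
      apply le_antisymm
      · exact Finset.sum_le_sum fun v _ => h v
      · rw [h2]; simp; omega
    have := (Finset.sum_eq_sum_iff_of_le (fun v _ => h v)).mp h3
    intro v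
    exact (this v (Finset.mem_univ v)).symm
  have hnb : ∀ x ∈ c.support, ∀ y, Q.Adj x y → s(x, y) ∈ c.edges := by
    intro x hx y hxy
    have h1 := hc.ncard_neighborSet_toSubgraph_eq_two hx
    have h2 : (Q.neighborSet x).ncard = 2 := by
      rw [← hdeg x, Set.ncard_eq_toFinset_card', ← SimpleGraph.card_neighborFinset_eq_degree]
      congr
    have h3 : c.toSubgraph.neighborSet x = Q.neighborSet x :=
      Set.eq_of_subset_of_ncard_le (c.toSubgraph.neighborSet_subset x) (by omega)
    have : y ∈ c.toSubgraph.neighborSet x := by rw [h3]; exact hxy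
    rw [SimpleGraph.Subgraph.mem_neighborSet] at this
    exact SimpleGraph.Walk.adj_toSubgraph_iff_mem_edges.mp this
  have hall : ∀ x, x ∈ c.support := by
    by_contra hne
    push Not at hne
    obtain ⟨x0, hx0⟩ := hne
    let U : Set W := {x | x ∉ c.support}
    have : Nonempty U := ⟨⟨x0, hx0⟩⟩
    have hcl : ∀ x ∈ U, ∀ y, Q.Adj x y → y ∈ U := by
      intro x hx y hxy hy
      exact hx (c.snd_mem_support_of_mem_edges (hnb y hy x hxy.symm))
    have hd : ∀ u : U, 2 ≤ (Q.induce U).degree u := by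
      intro u
      rw [← hdeg u.1]
      rw [← SimpleGraph.card_neighborFinset_eq_degree, ← SimpleGraph.card_neighborFinset_eq_degree]
      refine Finset.card_le_card_of_injOn (fun y => if hy : y ∈ U then ⟨y, hy⟩ else u) ?_ ?_
      · intro y hy
        have hy' : Q.Adj u.1 y := by simpa using hy
        have := hcl _ u.2 y hy'
        simp [this, hy']
      · intro y hy z hz hyz
        have hy' : Q.Adj u.1 y := by simpa using hy
        have hz' : Q.Adj u.1 z := by simpa using hz
        have h1 := hcl _ u.2 y hy'
        have h2 := hcl _ u.2 z hz'
        simpa [h1, h2] using hyz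
    obtain ⟨w, c', hc'⟩ := exists_cycle_of_deg hd
    have hmap := hc'.map (f := (SimpleGraph.Embedding.induce (G := Q) U).toHom)
      (SimpleGraph.Embedding.induce (G := Q) U).injective
    obtain ⟨e, he⟩ : ∃ e, e ∈ c.edges := by
      have := hc.three_le_length
      rw [← SimpleGraph.Walk.length_edges] at this
      exact List.exists_mem_of_length_pos (by omega)
    have := hu _ _ _ _ hc hmap e he
    rw [SimpleGraph.Walk.edges_map, List.mem_map] at this
    obtain ⟨e', he', rfl⟩ := this
    induction e' with
    | h a b =>
      exact a.2 (c.fst_mem_support_of_mem_edges he)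
  intro x y hxy
  exact hnb x (hall x) y hxy

end GraphLemmas
end EdgeIdealReg

namespace EdgeIdealReg
open scoped Classical

section Comb
variable {V : Type} (G : SimpleGraph V)

/-- Induced matchings inside `s`. -/
def IM (s : Finset V) (M : Finset (Sym2 V)) : Prop :=
  IsInducedMatchingSet G M ∧ ∀ e ∈ M, ∀ v ∈ e, v ∈ s

variable {G}

lemma IM.mono {s t : Finset V} (h : s ⊆ t) {M} (hM : IM G s M) : IM G t M :=
  ⟨hM.1, fun e he v hv => h (hM.2 e he v hv)⟩

lemma IM.empty (s : Finset V) : IM G s ∅ := by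
  refine ⟨⟨⟨?_, ?_⟩, ?_⟩, ?_⟩ <;> simp

lemma IM.simplicial {s : Finset V} {x y : V} (hx : x ∈ s) (hy : y ∈ s) (hxy : G.Adj x y)
    (hs : ∀ u ∈ s, ∀ v ∈ s, G.Adj y u → G.Adj y v → u ≠ v → G.Adj u v)
    {M} (hM : IM G (s.filter (fun v => v ≠ x ∧ ¬ G.Adj x v)) M) :
    ∃ M', IM G s M' ∧ M'.card = M.card + 1 := by
  have key : ∀ e ∈ M, ∀ w ∈ e, w ∈ s ∧ w ≠ x ∧ w ≠ y ∧ ¬ G.Adj x w ∧ ¬ G.Adj y w := by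
    intro e he w hw
    have := hM.2 e he w hw
    rw [Finset.mem_filter] at this
    obtain ⟨h1, h2, h3⟩ := this
    refine ⟨h1, h2, ?_, h3, ?_⟩
    · rintro rfl; exact h3 hxy
    · intro h
      exact h3 (hs x hx w h1 hxy.symm h h2.symm)
  have hnot : s(x, y) ∉ M := fun h => (key _ h x (by simp)).2.1 rfl
  refine ⟨insert s(x, y) M, ⟨⟨⟨?_, ?_⟩, ?_⟩, ?_⟩, Finset.card_insert_of_notMem hnot⟩
  · intro e he
    rw [Finset.coe_insert, Set.mem_insert_iff] at he
    rcases he with rfl | he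
    · exact hxy
    · exact hM.1.1.1 he
  · rw [Finset.coe_insert]
    refine hM.1.1.2.insert ?_
    intro e he _
    constructor
    · intro v hv hve
      have := key e he v hve
      rw [Sym2.mem_iff] at hv
      rcases hv with rfl | rfl <;> tauto
    · intro v hve hv
      have := key e he v hve
      rw [Sym2.mem_iff] at hv
      rcases hv with rfl | rfl <;> tauto
  · rw [Finset.coe_insert]
    refine hM.1.2.insert ?_
    intro e he _
    constructor
    · intro u v hu hve
      have := key e he v hve
      rw [Sym2.mem_iff] at hu
      rcases hu with rfl | rfl <;> tauto
    · intro v u hve hu huv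
      have := key e he v hve
      rw [Sym2.mem_iff] at hu
      have huv := huv.symm
      rcases hu with rfl | rfl <;> tauto
  · intro e he v hv
    rw [Finset.mem_insert] at he
    rcases he with rfl | he
    · rw [Sym2.mem_iff] at hv
      rcases hv with rfl | rfl
      · exact hx
      · exact hy
    · exact (key e he v hv).1

lemma IM.cycle {s : Finset V} {n : ℕ} (hn3 : 3 ≤ n) (hn : n % 3 ≠ 2) (f : ℕ → V)
    (hinj : ∀ i < n, ∀ j < n, f i = f j → i = j) (hf0 : f n = f 0)
    (hs : ∀ i < n, f i ∈ s) (hadj : ∀ i < n, G.Adj (f i) (f (i + 1)))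
    (hall : ∀ u ∈ s, ∀ v ∈ s, G.Adj u v → ∃ i < n, s(f i, f (i + 1)) = s(u, v))
    {M} (hM : IM G (s.filter (fun v => v ≠ f 0 ∧ ¬ G.Adj (f 0) v)) M) :
    ∃ M', IM G s M' ∧ M'.card = M.card + 1 := by
  have hA : ∀ i < n, ∀ j < n, i ≤ j → G.Adj (f i) (f j) → j = i + 1 ∨ (i = 0 ∧ j + 1 = n) := by
    intro i hi j hj hij had
    obtain ⟨k, hk, hkk⟩ := hall _ (hs i hi) _ (hs j hj) had
    rw [Sym2.eq_iff] at hkk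
    by_cases hk1 : k + 1 < n
    · rcases hkk with ⟨h1, h2⟩ | ⟨h1, h2⟩
      · have := hinj _ hk _ hi h1
        have := hinj _ hk1 _ hj h2
        omega
      · have := hinj _ hk _ hj h1
        have := hinj _ hk1 _ hi h2
        omega
    · have hk2 : k + 1 = n := by omega
      rw [hk2, hf0] at hkk
      rcases hkk with ⟨h1, h2⟩ | ⟨h1, h2⟩
      · have := hinj _ hk _ hi h1
        have := hinj 0 (by omega) _ hj h2
        omega
      · have := hinj _ hk _ hj h1
        have := hinj 0 (by omega) _ hi h2
        omega
  -- indices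
  have hidx : ∀ e ∈ M, ∃ i, 2 ≤ i ∧ i + 3 ≤ n ∧ e = s(f i, f (i + 1)) := by
    intro e he
    induction e with
    | h u v =>
      have hu := hM.2 _ he u (by simp)
      have hv := hM.2 _ he v (by simp)
      have huv : G.Adj u v := hM.1.1.1 he
      rw [Finset.mem_filter] at hu hv
      obtain ⟨i, hi, hie⟩ := hall u hu.1 v hv.1 huv
      refine ⟨i, ?_, ?_, hie.symm⟩
      all_goals
        have a1 : f i ≠ f 0 ∧ ¬ G.Adj (f 0) (f i) := by
          rw [Sym2.eq_iff] at hie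
          rcases hie with ⟨h1, h2⟩ | ⟨h1, h2⟩
          · rw [h1]; exact hu.2
          · rw [h1]; exact hv.2
        have a2 : f (i + 1) ≠ f 0 ∧ ¬ G.Adj (f 0) (f (i + 1)) := by
          rw [Sym2.eq_iff] at hie
          rcases hie with ⟨h1, h2⟩ | ⟨h1, h2⟩
          · rw [h2]; exact hv.2
          · rw [h2]; exact hu.2
      · by_contra hlt
        have : i = 0 ∨ i = 1 := by omega
        rcases this with rfl | rfl
        · exact a1.1 rfl
        · exact a1.2 (hadj 0 (by omega))
      · by_contra hlt
        have : i + 1 = n ∨ i + 1 + 1 = n := by omega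
        rcases this with h | h
        · rw [h] at a2; exact a2.1 hf0
        · apply a2.2
          have := hadj (i + 1) (by omega)
          rw [h, hf0] at this
          exact this.symm
  choose! φ hφ2 hφn hφe using hidx
  have hφm : ∀ e ∈ M, f (φ e) ∈ e ∧ f (φ e + 1) ∈ e := by
    intro e he
    have := hφe e he
    generalize φ e = i at this
    subst this
    simp
  have hgap : ∀ e ∈ M, ∀ e' ∈ M, φ e < φ e' → φ e + 3 ≤ φ e' := by
    intro e he e' he' hlt
    by_contra hc
    have hne : e ≠ e' := by rintro rfl; omega
    have : φ e' = φ e + 1 ∨ φ e' = φ e + 1 + 1 := by omega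
    rcases this with h | h
    · refine hM.1.1.2 he he' hne (f (φ e + 1)) ?_ ?_
      · exact (hφm e he).2
      · rw [← h]; exact (hφm e' he').1
    · refine hM.1.2 he he' hne (f (φ e + 1)) (f (φ e + 1 + 1)) ?_ ?_ (hadj _ ?_)
      · exact (hφm e he).2
      · rw [← h]; exact (hφm e' he').1
      · have := hφn e he; omega
  have hcard : M.card ≤ (n - 2) / 3 := by
    rw [← Finset.card_range ((n - 2) / 3)]
    refine Finset.card_le_card_of_injOn (fun e => (φ e - 2) / 3) ?_ ?_
    · intro e he
      have h1 := hφ2 e he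
      have h2 := hφn e he
      simp only [Finset.coe_range, Set.mem_Iio]
      omega
    · intro e he e' he' hee
      simp only at hee
      have h1 := hφ2 e he
      have h2 := hφ2 e' he'
      have h3 := hgap e he e' he'
      have h4 := hgap e' he' e he
      have : φ e = φ e' := by omega
      rw [hφe e he, hφe e' he', this]
  have hm : 3 * (M.card + 1) ≤ n := by omega
  have hinj' : ∀ j < M.card + 1, ∀ k < M.card + 1, ∀ a ≤ 1, ∀ b ≤ 1,
      f (3 * j + a) = f (3 * k + b) → j = k := by
    intro j hj k hk a ha b hb h
    have := hinj _ (by omega) _ (by omega) h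
    omega
  have hmem : ∀ j v, v ∈ s(f (3 * j), f (3 * j + 1)) → ∃ a ≤ 1, v = f (3 * j + a) := by
    intro j v hv
    rw [Sym2.mem_iff] at hv
    rcases hv with rfl | rfl
    · exact ⟨0, by omega, rfl⟩
    · exact ⟨1, by omega, rfl⟩
  refine ⟨(Finset.range (M.card + 1)).image (fun j => s(f (3 * j), f (3 * j + 1))),
    ⟨⟨⟨?_, ?_⟩, ?_⟩, ?_⟩, ?_⟩
  · intro e he
    simp only [Finset.coe_image, Finset.coe_range, Set.mem_image, Set.mem_Iio] at he
    obtain ⟨j, hj, rfl⟩ := he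
    exact hadj _ (by omega)
  · intro e he e' he' hne v hv hv'
    simp only [Finset.coe_image, Finset.coe_range, Set.mem_image, Set.mem_Iio] at he he'
    obtain ⟨j, hj, rfl⟩ := he
    obtain ⟨k, hk, rfl⟩ := he'
    obtain ⟨a, ha, rfl⟩ := hmem _ _ hv
    obtain ⟨b, hb, hab⟩ := hmem _ _ hv'
    have := hinj' _ hj _ hk _ ha _ hb hab
    exact hne (by rw [this])
  · intro e he e' he' hne u v hu hv hadj'
    simp only [Finset.coe_image, Finset.coe_range, Set.mem_image, Set.mem_Iio] at he he'
    obtain ⟨j, hj, rfl⟩ := he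
    obtain ⟨k, hk, rfl⟩ := he'
    have hjk : j ≠ k := by rintro rfl; exact hne rfl
    obtain ⟨a, ha, rfl⟩ := hmem _ _ hu
    obtain ⟨b, hb, rfl⟩ := hmem _ _ hv
    rcases Nat.lt_or_ge j k with h | h
    · have := hA _ (by omega) _ (by omega) (by omega) hadj'
      omega
    · have := hA _ (by omega) _ (by omega) (by omega) hadj'.symm
      omega
  · intro e he v hv
    simp only [Finset.mem_image, Finset.mem_range] at he
    obtain ⟨j, hj, rfl⟩ := he
    obtain ⟨a, ha, rfl⟩ := hmem _ _ hv
    exact hs _ (by omega)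
  · rw [Finset.card_image_of_injOn, Finset.card_range]
    intro j hj k hk h
    simp only [Finset.coe_range, Set.mem_Iio] at hj hk
    have : f (3 * j) ∈ s(f (3 * k), f (3 * k + 1)) := by
      simp only at h
      rw [← h]; simp
    obtain ⟨b, hb, hab⟩ := hmem _ _ this
    exact hinj' j hj k hk 0 (by omega) b hb hab

end Comb
end EdgeIdealReg

namespace EdgeIdealReg
open scoped Classical

section Upper
variable {V K : Type} [Field K] [Fintype V]

lemma exists_vertex (G : SimpleGraph V) (Hset T : Set V) (huni : Unicyclic (G.induce Hset))
    (hlen : ∀ (w : Hset) (c : (G.induce Hset).Walk w w), c.IsCycle → c.length % 3 ≠ 2)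
    (hatt : Nonempty (CliqueAttachment G Hset T)) (s : Finset V)
    (hedge : ∃ u ∈ s, ∃ v ∈ s, G.Adj u v) :
    ∃ x ∈ s, ∀ M, IM G (s.filter (fun v => v ≠ x ∧ ¬ G.Adj x v)) M →
      ∃ M', IM G s M' ∧ M'.card = M.card + 1 := by
  by_cases hsimp : ∃ y ∈ s, (∃ x ∈ s, G.Adj x y) ∧
      ∀ u ∈ s, ∀ v ∈ s, G.Adj y u → G.Adj y v → u ≠ v → G.Adj u v
  · obtain ⟨y, hy, ⟨x, hx, hxy⟩, h⟩ := hsimp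
    exact ⟨x, hx, fun M hM => IM.simplicial hx hy hxy h hM⟩
  push Not at hsimp
  obtain ⟨A⟩ := hatt
  let D : Set V := {u | u ∈ s ∧ ∃ v ∈ s, G.Adj v u}
  have hD2 : ∀ y ∈ D, ∃ u ∈ s, ∃ v ∈ s, G.Adj y u ∧ G.Adj y v ∧ u ≠ v ∧ ¬ G.Adj u v := by
    intro y hy
    exact hsimp y hy.1 hy.2
  have hDH : D ⊆ Hset := by
    intro y hy
    by_contra hyH
    have hyc : y ∈ Hset ∪ (⋃ i, (A.C i : Set V)) := by rw [A.cover]; trivial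
    rcases hyc with h | h
    · exact hyH h
    rw [Set.mem_iUnion] at h
    obtain ⟨i, hi⟩ := h
    have hnb : ∀ u, G.Adj y u → u ∈ A.C i := by
      intro u hu
      rcases A.edges_sub y u hu with h | ⟨j, hj1, hj2⟩
      · exact absurd h.1 hyH
      · by_cases hij : i = j
        · subst hij; exact hj2
        · have : y ∈ ({A.a i} : Set V) := A.pairwise_inter i j hij ⟨hi, hj1⟩
          rw [Set.mem_singleton_iff] at this
          exact absurd (this ▸ A.T_sub (A.a_mem_T i)) hyH
    obtain ⟨u, _, v, _, h1, h2, h3, h4⟩ := hD2 y hy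
    exact h4 (A.clique i (hnb u h1) (hnb v h2) h3)
  let φ := G.induceHomOfLE hDH
  have hφ : Function.Injective φ.toHom := φ.injective
  obtain ⟨u0, hu0, v0, hv0, huv0⟩ := hedge
  have : Nonempty D := ⟨⟨u0, hu0, v0, hv0, huv0.symm⟩⟩
  have hdeg : ∀ y : D, 2 ≤ (G.induce D).degree y := by
    intro y
    obtain ⟨u, hu, v, hv, h1, h2, h3, h4⟩ := hD2 y.1 y.2
    rw [← SimpleGraph.card_neighborFinset_eq_degree]
    have hu' : u ∈ D := ⟨hu, y.1, y.2.1, h1⟩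
    have hv' : v ∈ D := ⟨hv, y.1, y.2.1, h2⟩
    have : ({⟨u, hu'⟩, ⟨v, hv'⟩} : Finset D) ⊆ (G.induce D).neighborFinset y := by
      intro z hz
      rw [Finset.mem_insert, Finset.mem_singleton] at hz
      rw [SimpleGraph.mem_neighborFinset]
      rcases hz with rfl | rfl
      · exact h1
      · exact h2
    have hc := Finset.card_le_card this
    rwa [Finset.card_pair (by simpa using h3)] at hc
  obtain ⟨w, c, hc, hall⟩ := unique_cycle hdeg (by
    intro v c w c' hc hc' e he
    obtain ⟨v1, c1, hc1, hu⟩ := huni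
    have e1 := hu _ _ (hc.map hφ)
    have e2 := hu _ _ (hc'.map hφ)
    have : Sym2.map φ.toHom e ∈ {e | e ∈ (c.map φ.toHom).edges} := by
      rw [Set.mem_setOf_eq, SimpleGraph.Walk.edges_map]
      exact List.mem_map_of_mem he
    rw [e1, ← e2, Set.mem_setOf_eq, SimpleGraph.Walk.edges_map, List.mem_map] at this
    obtain ⟨e', he', hee⟩ := this
    rwa [← Sym2.map.injective hφ hee])
  have hl := hlen _ _ (hc.map hφ)
  rw [SimpleGraph.Walk.length_map] at hl
  refine ⟨(c.getVert 0).1, (c.getVert 0).2.1, fun M hM =>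
    IM.cycle hc.three_le_length hl (fun i => (c.getVert i).1) ?_ ?_ ?_ ?_ ?_ hM⟩
  · intro i hi j hj h
    exact hc.getVert_injOn' (Nat.le_sub_one_of_lt hi) (Nat.le_sub_one_of_lt hj) (Subtype.ext h)
  · simp
  · intro i _; exact (c.getVert i).2.1
  · intro i hi; exact c.adj_getVert_succ hi
  · intro u hu v hv huv
    have h1 := hall ⟨u, hu, v, hv, huv.symm⟩ ⟨v, hv, u, hu, huv⟩ huv
    rw [← SimpleGraph.Walk.adj_toSubgraph_iff_mem_edges, SimpleGraph.Walk.toSubgraph_adj_iff] at h1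
    obtain ⟨i, h, hi⟩ := h1
    refine ⟨i, hi, ?_⟩
    exact congrArg (Sym2.map Subtype.val) h

lemma reg_upper (G : SimpleGraph V) (Hset T : Set V) (huni : Unicyclic (G.induce Hset))
    (hlen : ∀ (w : Hset) (c : (G.induce Hset).Walk w w), c.IsCycle → c.length % 3 ≠ 2)
    (hatt : Nonempty (CliqueAttachment G Hset T)) :
    ∀ (n : ℕ) (s : Finset V), s.card = n → ∀ d, (∀ M, IM G s M → M.card ≤ d) → Reg G K s d := by
  intro n
  induction n using Nat.strong_induction_on with
  | _ n ih =>
  intro s hs d hd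
  by_cases hedge : ∃ u ∈ s, ∃ v ∈ s, G.Adj u v
  · obtain ⟨x, hx, hxM⟩ := exists_vertex G Hset T huni hlen hatt s hedge
    obtain ⟨M0, hM0, hc0⟩ := hxM ∅ (IM.empty _)
    have := hd M0 hM0
    obtain ⟨d, rfl⟩ : ∃ d', d = d' + 1 := ⟨d - 1, by omega⟩
    apply Reg.step G hx
    · refine ih _ ?_ _ rfl _ ?_
      · rw [← hs]; exact Finset.card_erase_lt_of_mem hx
      · intro M hM
        exact hd M (hM.mono (Finset.erase_subset _ _))
    · refine ih _ ?_ _ rfl _ ?_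
      · rw [← hs]
        apply Finset.card_lt_card
        rw [Finset.ssubset_iff_of_subset (Finset.filter_subset _ _)]
        exact ⟨x, hx, by simp⟩
      · intro M hM
        obtain ⟨M', hM', hc'⟩ := hxM M hM
        have := hd M' hM'
        omega
  · push Not at hedge
    exact (Reg.zero G hedge).mono G (Nat.zero_le d)

end Upper
end EdgeIdealReg

namespace EdgeIdealReg
open scoped Classical

section Koszul
variable {V K : Type} [Field K] [Fintype V]

/-- Sign between two vertices. -/
def sg (K : Type) [Field K] (ord : V → ℕ) (v a : V) : K := if ord v < ord a then -1 else 1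

/-- Sign of a vertex with respect to a set. -/
def sgn (K : Type) [Field K] (ord : V → ℕ) (v : V) (A : Finset V) : K := ∏ a ∈ A, sg K ord v a

/-- Koszul differential. -/
def kd (ord : V → ℕ) (c : Finset V → MvPolynomial V K) (A : Finset V) : MvPolynomial V K :=
  ∑ v ∈ Aᶜ, C (sgn K ord v A) * (X v * c (insert v A))

variable {ord : V → ℕ}

lemma sgn_insert {u v : V} {A : Finset V} (h : v ∉ A) :
    sgn K ord u (insert v A) = sg K ord u v * sgn K ord u A := by
  rw [sgn, Finset.prod_insert h]; rfl

lemma kd_kd (ho : Function.Injective ord) (c : Finset V → MvPolynomial V K) (A : Finset V) :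
    kd ord (kd ord c) A = 0 := by
  have e : kd ord (kd ord c) A = ∑ p ∈ (Aᶜ ×ˢ Aᶜ).filter (fun p : V × V => p.1 ≠ p.2),
      C (sgn K ord p.1 A * (sg K ord p.2 p.1 * sgn K ord p.2 A)) *
        (X p.1 * X p.2 * c (insert p.2 (insert p.1 A))) := by
    rw [Finset.sum_filter, Finset.sum_product, kd]
    refine Finset.sum_congr rfl fun v hv => ?_
    have hv' : v ∉ A := by simpa using hv
    rw [kd, Finset.mul_sum, Finset.mul_sum, ← Finset.sum_filter]
    refine Finset.sum_congr ?_ ?_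
    · ext u
      simp only [Finset.mem_compl, Finset.mem_insert, Finset.mem_filter]
      tauto
    · intro u hu
      rw [sgn_insert hv']
      simp only [map_mul]
      ring
  rw [e]
  refine Finset.sum_involution (fun p _ => (p.2, p.1)) ?_ ?_ ?_ ?_
  · rintro ⟨u, v⟩ h
    simp only [Finset.mem_filter, Finset.mem_product, Finset.mem_compl] at h
    have h1 : sg K ord v u = - sg K ord u v := by
      have : ord u ≠ ord v := fun h' => h.2 (ho h')
      unfold sg
      rcases Nat.lt_or_ge (ord u) (ord v) with h' | h'
      · rw [if_neg (by omega), if_pos h']; ring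
      · rw [if_pos (by omega), if_neg (by omega)]
    simp only
    rw [Finset.insert_comm u v, h1]
    simp only [map_mul, map_neg]
    ring
  · rintro ⟨u, v⟩ h _ h'
    simp only [Finset.mem_filter] at h
    simp only [Prod.mk.injEq] at h'
    exact h.2 h'.2
  · rintro ⟨u, v⟩ h
    simp only [Finset.mem_filter, Finset.mem_product] at h ⊢
    exact ⟨⟨h.1.2, h.1.1⟩, h.2.symm⟩
  · rintro ⟨u, v⟩ h; rfl

lemma kd_lin {r : ℕ} (m : Fin r → MvPolynomial V K) (z : Fin r → Finset V → MvPolynomial V K)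
    (A : Finset V) :
    kd ord (fun B => ∑ j, m j * z j B) A = ∑ j, m j * kd ord (z j) A := by
  unfold kd
  simp_rw [Finset.mul_sum]
  rw [Finset.sum_comm]
  refine Finset.sum_congr rfl fun j _ => Finset.sum_congr rfl fun v _ => ?_
  ring

lemma kd_sub (c c' : Finset V → MvPolynomial V K) (A : Finset V) :
    kd ord (fun B => c B - c' B) A = kd ord c A - kd ord c' A := by
  unfold kd
  rw [← Finset.sum_sub_distrib]
  refine Finset.sum_congr rfl fun v _ => ?_
  ring

lemma exists_poly (q : MvPolynomial V K) (x : V) (P : (V →₀ ℕ) → Prop) :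
    ∃ p : MvPolynomial V K, ∀ b, coeff b p = if P b then coeff (Finsupp.single x 1 + b) q else 0 := by
  let r := q.divMonomial (Finsupp.single x 1)
  refine ⟨∑ m ∈ r.support.filter P, monomial m (coeff m r), fun b => ?_⟩
  rw [coeff_sum]
  simp_rw [coeff_monomial]
  rw [Finset.sum_ite_eq']
  have : coeff b r = coeff (Finsupp.single x 1 + b) q := coeff_divMonomial _ _ _
  rw [← this]
  by_cases hP : P b
  · by_cases h0 : coeff b r = 0
    · simp [h0]
    · simp [hP, h0]
  · simp [hP]

lemma kd_coeff (c : Finset V → MvPolynomial V K) (A : Finset V) (a : V →₀ ℕ) :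
    coeff a (kd ord c A) = ∑ v ∈ Aᶜ, if a v ≠ 0 then
      sgn K ord v A * coeff (a - Finsupp.single v 1) (c (insert v A)) else 0 := by
  rw [kd, coeff_sum]
  refine Finset.sum_congr rfl fun v _ => ?_
  rw [coeff_C_mul, coeff_X_mul']
  simp only [Finsupp.mem_support_iff]
  split_ifs <;> simp

/-- Exactness of the Koszul complex. -/
lemma kd_exact (ho : Function.Injective ord) (c : Finset V → MvPolynomial V K)
    (hc : ∀ A, kd ord c A = 0) (h0 : coeff 0 (c ∅) = 0) :
    ∃ w : Finset V → MvPolynomial V K, w ∅ = 0 ∧ ∀ A, kd ord w A = c A := by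
  have hex : ∀ B : Finset V, ∃ p : MvPolynomial V K, ∀ b v0, v0 ∈ B → (∀ u ∈ B, ord u ≤ ord v0) →
      coeff b p = if (∀ u, b u ≠ 0 → ord u ≤ ord v0) then
        coeff (Finsupp.single v0 1 + b) (c (B.erase v0)) else 0 := by
    intro B
    rcases B.eq_empty_or_nonempty with rfl | hB
    · exact ⟨0, by simp⟩
    obtain ⟨x, hx, hmax⟩ := Finset.exists_max_image B ord hB
    obtain ⟨p, hp⟩ := exists_poly (c (B.erase x)) x (fun b => ∀ u, b u ≠ 0 → ord u ≤ ord x)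
    refine ⟨p, fun b v0 hv0 hv => ?_⟩
    have : v0 = x := ho (le_antisymm (hmax v0 hv0) (hv x hx))
    subst this
    rw [hp b]; congr
  choose w hw using hex
  refine ⟨fun B => if B = ∅ then 0 else w B, by simp, fun A => ?_⟩
  ext a
  rw [kd_coeff]
  simp only [Finset.insert_ne_empty, if_false]
  by_cases hne : a = 0 ∧ A = ∅
  · obtain ⟨rfl, rfl⟩ := hne
    simp [h0]
  obtain ⟨v0, hv0, hmax⟩ := Finset.exists_max_image (a.support ∪ A) ord (by
    rw [Finset.union_nonempty]
    by_contra hcon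
    simp only [not_or, Finset.not_nonempty_iff_eq_empty, Finsupp.support_eq_empty] at hcon
    exact hne hcon)
  have hmaxa : ∀ u, a u ≠ 0 → ord u ≤ ord v0 := fun u hu => hmax u (by simp [hu])
  have hmaxA : ∀ u ∈ A, ord u ≤ ord v0 := fun u hu => hmax u (by simp [hu])
  have hsub : ∀ v u, (a - Finsupp.single v 1 : V →₀ ℕ) u ≠ 0 → a u ≠ 0 := by
    intro v u h h'
    apply h
    rw [Finsupp.tsub_apply, h', Nat.zero_sub]
  by_cases hvA : v0 ∈ A
  · -- use the cycle condition
    have hcyc := congrArg (coeff (Finsupp.single v0 1 + a)) (hc (A.erase v0))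
    rw [kd_coeff, coeff_zero] at hcyc
    have hcompl : (A.erase v0)ᶜ = insert v0 Aᶜ := by
      rw [Finset.compl_erase]
    rw [hcompl, Finset.sum_insert (by simpa using hvA), Finset.insert_erase hvA] at hcyc
    have hs1 : sgn K ord v0 (A.erase v0) = 1 := by
      apply Finset.prod_eq_one
      intro u hu
      have := hmaxA u (Finset.mem_of_mem_erase hu)
      unfold sg
      rw [if_neg (by omega)]
    rw [if_pos (by simp), hs1, one_mul, add_tsub_cancel_left] at hcyc
    rw [eq_neg_of_add_eq_zero_left hcyc, ← Finset.sum_neg_distrib]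
    refine Finset.sum_congr rfl fun v hv => ?_
    have hv' : v ∉ A := by simpa using hv
    have hvv : v ≠ v0 := by rintro rfl; exact hv' hvA
    have hav : (Finsupp.single v0 1 + a : V →₀ ℕ) v = a v := single_add_ne hvv
    rw [hav]
    by_cases h : a v = 0
    · simp [h]
    · rw [if_pos h, if_pos h]
      rw [hw (insert v A) _ v0 (by simp [hvA]) ?_, if_pos]
      · have hlt : ord v < ord v0 :=
          lt_of_le_of_ne (hmaxa v h) (fun h' => hvv (ho h'))
        have hs2 : sgn K ord v A = - sgn K ord v (A.erase v0) := by
          conv_lhs => rw [← Finset.insert_erase hvA]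
          rw [sgn_insert (by simp)]
          unfold sg
          rw [if_pos hlt]; ring
        have h3 : (insert v A).erase v0 = insert v (A.erase v0) := by
          rw [Finset.erase_insert_of_ne hvv]
        have h4 : Finsupp.single v0 1 + (a - Finsupp.single v 1)
            = Finsupp.single v0 1 + a - Finsupp.single v 1 := by
          rw [add_tsub_assoc_of_le]
          rw [Finsupp.single_le_iff]; omega
        rw [hs2, h3, h4]; ring
      · intro u hu
        exact hmaxa u (hsub v u hu)
      · intro u hu
        rcases Finset.mem_insert.mp hu with rfl | hu
        · exact hmaxa _ h
        · exact hmaxA u hu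
  · have hva : a v0 ≠ 0 := by
      rcases Finset.mem_union.mp hv0 with h | h
      · simpa using h
      · exact absurd h hvA
    rw [Finset.sum_eq_single v0]
    · rw [if_pos hva, hw (insert v0 A) _ v0 (by simp) ?_, if_pos]
      · have hs1 : sgn K ord v0 A = 1 := by
          apply Finset.prod_eq_one
          intro u hu
          have := hmaxA u hu
          unfold sg
          rw [if_neg (by omega)]
        rw [hs1, one_mul, Finset.erase_insert hvA, add_tsub_cancel_of_le]
        rw [Finsupp.single_le_iff]; omega
      · intro u hu
        exact hmaxa u (hsub _ u hu)
      · intro u hu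
        rcases Finset.mem_insert.mp hu with rfl | hu
        · exact le_rfl
        · exact hmaxA u hu
    · intro v hv hvv
      split_ifs with h
      · obtain ⟨x, hx, hxm⟩ := Finset.exists_max_image (insert v A) ord (by simp)
        rw [hw (insert v A) _ x hx hxm, if_neg, mul_zero]
        intro hcon
        have h1 := hcon v0 (by
          rw [Finsupp.tsub_apply, Finsupp.single_apply, if_neg hvv]
          simpa using hva)
        have hxv : x ≠ v0 := by
          rintro rfl
          rcases Finset.mem_insert.mp hx with h | h
          · exact hvv h.symm
          · exact hvA h
        apply hxv
        apply ho
        apply le_antisymm _ h1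
        rcases Finset.mem_insert.mp hx with rfl | h
        · exact hmaxa _ ‹_›
        · exact hmaxA x h
      · rfl
    · intro h
      simp [hvA] at h

end Koszul
end EdgeIdealReg

namespace EdgeIdealReg
open scoped Classical

section ZigZag
variable {V K : Type} [Field K] [Fintype V] {ord : V → ℕ}

lemma zigzag (ho : Function.Injective ord) {I : Ideal (MvPolynomial V K)}
    (F : GradedFreeResolution I) (t : ℕ) : ∀ (p i : ℕ)
    (z : Fin (F.rank i) → Finset V → MvPolynomial V K)
    (_ : ∀ k A, A.card ≠ p → z k A = 0)
    (_ : ∀ k A, HH t (F.deg i k + p) (z k A))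
    (_ : ∀ A, (fun k => kd ord (z k) A) ∈ LinearMap.range (Matrix.mulVecLin (F.mat i)))
    (_ : ∀ n, n = i + p → ∀ k : Fin (F.rank n), F.deg n k < t),
    ∃ (w : Fin (F.rank i) → Finset V → MvPolynomial V K)
      (y : Finset V → Fin (F.rank (i + 1)) → MvPolynomial V K),
      (∀ k, w k ∅ = 0) ∧ ∀ k A, z k A = kd ord (w k) A + (F.mat i).mulVec (y A) k := by
  intro p
  induction p with
  | zero =>
    intro i z hz hh _ hd
    have h : ∀ k, ∃ w : Finset V → MvPolynomial V K, w ∅ = 0 ∧ ∀ A, kd ord w A = z k A := by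
      intro k
      apply kd_exact ho
      · intro A
        apply Finset.sum_eq_zero
        intro v _
        rw [hz k (insert v A) (by rw [Finset.card_ne_zero]; simp)]
        simp
      · rcases hh k ∅ with h | ⟨e, he, h⟩
        · rw [h]; simp
        · by_contra hne
          have h1 := h hne
          have h2 := hd i (by omega) k
          simp at h1
          omega
    choose w hw0 hw using h
    refine ⟨w, fun _ => 0, hw0, fun k A => ?_⟩
    rw [hw]; simp
  | succ p ih =>
    intro i z hz hh hr hd
    -- lift the Koszul boundary
    have hlift : ∀ A : Finset V, ∃ x : Fin (F.rank (i + 1)) → MvPolynomial V K,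
        (∀ j, HH t (F.deg (i + 1) j + p) (x j)) ∧ (A.card ≠ p → x = 0) ∧
        ∀ k, (F.mat i).mulVec x k = kd ord (z k) A := by
      intro A
      by_cases hA : A.card = p
      · obtain ⟨x, hx1, hx2⟩ := graded_lift (F.mat i) (fun k => F.deg i k + p)
          (fun j => F.deg (i + 1) j + p) (fun k j => HH.shift (F.homog i k j)) t
          (fun k => kd ord (z k) A) (by
            intro k
            apply HH.sum
            intro v _
            rcases hh k (insert v A) with h | ⟨e, he, h⟩
            · left; rw [h]; simp
            · right
              refine ⟨e + 1, by omega, ?_⟩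
              have := (isHomogeneous_C V (sgn K ord v A)).mul ((isHomogeneous_X K v).mul h)
              convert this using 1
              omega) (hr A)
        exact ⟨x, hx1, fun h => absurd hA h, fun k => congrFun hx2 k⟩
      · refine ⟨0, fun j => HH.zero _ _, fun _ => rfl, fun k => ?_⟩
        rw [Matrix.mulVec_zero]
        symm
        apply Finset.sum_eq_zero
        intro v hv
        rw [hz k (insert v A) (by
          rw [Finset.card_insert_of_notMem (by simpa using hv)]; omega)]
        simp
    choose x hx1 hx2 hx3 using hlift
    have hz1 : ∀ (k : Fin (F.rank i)) A, kd ord (z k) A = ∑ j, F.mat i k j * x A j := by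
      intro k A
      rw [← hx3 A k]; rfl
    obtain ⟨w1, y1, hw1, hwy⟩ := ih (i + 1) (fun j A => x A j)
      (fun k A hA => by rw [hx2 A hA]; rfl) (fun k A => hx1 A k) (by
        intro A
        rw [← F.isExact i, LinearMap.mem_ker]
        funext k
        rw [Matrix.mulVecLin_apply]
        have e1 : kd ord (fun B => kd ord (z k) B) A = 0 := kd_kd ho (z k) A
        have e2 : (fun B => kd ord (z k) B) = fun B => ∑ j, F.mat i k j * x B j := by
          funext B; exact hz1 k B
        rw [e2, kd_lin (fun j => F.mat i k j) (fun j B => x B j)] at e1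
        exact e1) (fun n hn => hd n (by omega))
    have h : ∀ k, ∃ w : Finset V → MvPolynomial V K, w ∅ = 0 ∧
        ∀ A, kd ord w A = z k A - ∑ j, F.mat i k j * w1 j A := by
      intro k
      apply kd_exact ho (fun A => z k A - ∑ j, F.mat i k j * w1 j A)
      · intro A
        rw [kd_sub, kd_lin (fun j => F.mat i k j) w1, hz1 k A, ← Finset.sum_sub_distrib]
        have hker : (F.mat (i + 1)).mulVec (y1 A) ∈ LinearMap.ker (Matrix.mulVecLin (F.mat i)) := by
          rw [F.isExact i]
          exact ⟨y1 A, rfl⟩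
        have := congrFun (LinearMap.mem_ker.mp hker) k
        rw [Matrix.mulVecLin_apply] at this
        rw [← show _ = (0 : MvPolynomial V K) from this]
        refine Finset.sum_congr rfl fun j _ => ?_
        have h' : x A j = kd ord (w1 j) A + (F.mat (i + 1)).mulVec (y1 A) j := hwy j A
        rw [h']
        exact (mul_sub _ _ _).symm.trans (congrArg _ (add_sub_cancel_left _ _))
      · rw [hz k ∅ (by simp)]
        simp [hw1]
    choose w hw0 hw using h
    refine ⟨w, fun A j => w1 j A, hw0, fun k A => ?_⟩
    rw [hw k A]
    show z k A = z k A - ∑ j, F.mat i k j * w1 j A + ∑ j, F.mat i k j * w1 j A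
    ring

end ZigZag
end EdgeIdealReg

namespace EdgeIdealReg
open scoped Classical

section Lower
variable {V K : Type} [Field K] [Fintype V] {n : ℕ}

/-- Transversal. -/
def tr (q : Fin n → Bool → V) (τ : Fin n → Bool) : Finset V :=
  Finset.univ.image (fun i => q i (τ i))

/-- Exponent of a transversal. -/
def tex (q : Fin n → Bool → V) (τ : Fin n → Bool) : V →₀ ℕ :=
  ∑ i, Finsupp.single (q i (τ i)) 1

/-- Complementary choice. -/
def cpl (τ : Fin n → Bool) : Fin n → Bool := fun i => !(τ i)

/-- The functional detecting the induced matching. -/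
def Phi (q : Fin n → Bool → V) (c : Finset V → MvPolynomial V K) : K :=
  ∑ τ : Fin n → Bool, coeff (tex q (cpl τ)) (c (tr q τ))

lemma tex_apply (q : Fin n → Bool → V) (τ : Fin n → Bool) (v : V) :
    tex q τ v ≠ 0 ↔ v ∈ tr q τ := by
  rw [tex, Finsupp.finsetSum_apply, Ne, Finset.sum_eq_zero_iff]
  simp [tr, Finsupp.single_apply]

/-- Flip a choice at one place. -/
def flp (τ : Fin n → Bool) (i : Fin n) : Fin n → Bool := Function.update τ i (!(τ i))

lemma exists_ord (q : Fin n → Bool → V) (hq : ∀ i a j b, q i a = q j b → i = j ∧ a = b) :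
    ∃ ord : V → ℕ, Function.Injective ord ∧
      ∀ i a, ord (q i a) = 2 * i.1 + (if a = true then 1 else 0) := by
  let e : V → ℕ := fun v => (Fintype.equivFin V v).1
  have he : Function.Injective e := fun a b h => (Fintype.equivFin V).injective (Fin.ext h)
  let ord : V → ℕ := fun v => if h : ∃ p : Fin n × Bool, q p.1 p.2 = v then
    2 * h.choose.1.1 + (if h.choose.2 = true then 1 else 0) else 2 * n + e v
  have h1 : ∀ i a, ord (q i a) = 2 * i.1 + (if a = true then 1 else 0) := by
    intro i a
    have hex : ∃ p : Fin n × Bool, q p.1 p.2 = q i a := ⟨(i, a), rfl⟩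
    have h := hq _ _ _ _ hex.choose_spec
    simp only [ord]
    rw [dif_pos hex, h.1, h.2]
  have h2 : ∀ v, (¬ ∃ p : Fin n × Bool, q p.1 p.2 = v) → ord v = 2 * n + e v := by
    intro v hv
    simp only [ord]
    rw [dif_neg hv]
  refine ⟨ord, ?_, h1⟩
  intro u v huv
  by_cases hu : ∃ p : Fin n × Bool, q p.1 p.2 = u
  · obtain ⟨⟨i, a⟩, rfl⟩ := hu
    by_cases hv : ∃ p : Fin n × Bool, q p.1 p.2 = v
    · obtain ⟨⟨j, b⟩, rfl⟩ := hv
      simp only at huv ⊢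
      rw [h1, h1] at huv
      have hij : i = j := by
        apply Fin.ext
        split_ifs at huv <;> omega
      have hab : a = b := by
        cases a <;> cases b <;> simp at huv ⊢ <;> omega
      rw [hij, hab]
    · simp only at huv
      rw [h1, h2 v hv] at huv
      have := i.2
      split_ifs at huv <;> omega
  · by_cases hv : ∃ p : Fin n × Bool, q p.1 p.2 = v
    · obtain ⟨⟨j, b⟩, rfl⟩ := hv
      simp only at huv
      rw [h1, h2 u hu] at huv
      have := j.2
      split_ifs at huv <;> omega
    · rw [h2 u hu, h2 v hv] at huv
      exact he (by omega)

lemma sgn_tr {ord : V → ℕ} (q : Fin n → Bool → V) (hq : ∀ i a j b, q i a = q j b → i = j ∧ a = b)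
    (τ : Fin n → Bool) (v : V) : sgn K ord v (tr q τ) = ∏ j, sg K ord v (q j (τ j)) := by
  rw [sgn, tr, Finset.prod_image]
  intro i _ j _ h
  exact (hq _ _ _ _ h).1

lemma Phi_kd {ord : V → ℕ} (q : Fin n → Bool → V)
    (hq : ∀ i a j b, q i a = q j b → i = j ∧ a = b)
    (hord : ∀ i a, ord (q i a) = 2 * i.1 + (if a = true then 1 else 0))
    (w : Finset V → MvPolynomial V K) : Phi q (kd ord w) = 0 := by
  let g : (Fin n → Bool) × Fin n → K := fun p =>
    sgn K ord (q p.2 (!(p.1 p.2))) (tr q p.1) *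
      coeff (tex q (cpl p.1) - Finsupp.single (q p.2 (!(p.1 p.2))) 1)
        (w (insert (q p.2 (!(p.1 p.2))) (tr q p.1)))
  have e : Phi q (kd ord w) = ∑ p : (Fin n → Bool) × Fin n, g p := by
    rw [Fintype.sum_prod_type, Phi]
    refine Finset.sum_congr rfl fun τ _ => ?_
    rw [kd_coeff]
    have hsub : tr q (cpl τ) ⊆ (tr q τ)ᶜ := by
      intro v hv
      rw [Finset.mem_compl]
      intro hv'
      simp only [tr, Finset.mem_image, Finset.mem_univ, true_and] at hv hv'
      obtain ⟨i, rfl⟩ := hv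
      obtain ⟨j, hj⟩ := hv'
      have := hq _ _ _ _ hj
      obtain ⟨rfl, h⟩ := this
      simp [cpl] at h
    rw [← Finset.sum_subset hsub, tr, Finset.sum_image]
    · refine Finset.sum_congr rfl fun i _ => ?_
      rw [if_pos]
      · rfl
      · rw [tex_apply]
        simp only [tr, Finset.mem_image, Finset.mem_univ, true_and]
        exact ⟨i, rfl⟩
    · intro i _ j _ h
      exact (hq _ _ _ _ h).1
    · intro v _ hv
      rw [if_neg]
      rw [tex_apply]
      exact hv
  rw [e]
  refine Finset.sum_involution (fun p _ => (flp p.1 p.2, p.2)) ?_ ?_ ?_ ?_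
  · rintro ⟨τ, i⟩ _
    have hfi : flp τ i i = !(τ i) := by simp [flp]
    have hfj : ∀ j, j ≠ i → flp τ i j = τ j := by
      intro j hj; simp [flp, hj]
    have h1 : insert (q i (!(τ i))) (tr q τ) = insert (q i (τ i)) (tr q (flp τ i)) := by
      ext v
      simp only [tr, Finset.mem_insert, Finset.mem_image, Finset.mem_univ, true_and]
      constructor
      · rintro (rfl | ⟨j, rfl⟩)
        · right; exact ⟨i, by rw [hfi]⟩
        · by_cases hj : j = i
          · subst hj; left; rfl
          · right; exact ⟨j, by rw [hfj j hj]⟩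
      · rintro (rfl | ⟨j, rfl⟩)
        · right; exact ⟨i, rfl⟩
        · by_cases hj : j = i
          · subst hj; left; rw [hfi]
          · right; exact ⟨j, by rw [hfj j hj]⟩
    have hex : ∀ σ : Fin n → Bool, tex q σ - Finsupp.single (q i (σ i)) 1 =
        ∑ j ∈ Finset.univ.erase i, Finsupp.single (q j (σ j)) 1 := by
      intro σ
      rw [tex, ← Finset.add_sum_erase _ _ (Finset.mem_univ i), add_tsub_cancel_left]
    have h2 : tex q (cpl τ) - Finsupp.single (q i (!(τ i))) 1 =
        tex q (cpl (flp τ i)) - Finsupp.single (q i (!(flp τ i i))) 1 := by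
      have a1 := hex (cpl τ)
      have a2 := hex (cpl (flp τ i))
      simp only [cpl] at a1 a2 ⊢
      rw [a1, a2]
      refine Finset.sum_congr rfl fun j hj => ?_
      rw [hfj j (Finset.ne_of_mem_erase hj)]
    have h3 : sgn K ord (q i (!(τ i))) (tr q τ) =
        - sgn K ord (q i (!(flp τ i i))) (tr q (flp τ i)) := by
      rw [sgn_tr q hq, sgn_tr q hq, ← Finset.mul_prod_erase _ _ (Finset.mem_univ i),
        ← Finset.mul_prod_erase _ _ (Finset.mem_univ i), ← neg_mul]
      congr 1
      · rw [hfi, Bool.not_not]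
        unfold sg
        rw [hord, hord]
        cases τ i <;> simp
      · refine Finset.prod_congr rfl fun j hj => ?_
        have hji := Finset.ne_of_mem_erase hj
        have hji' : j.1 ≠ i.1 := fun h => hji (Fin.ext h)
        rw [hfj j hji]
        unfold sg
        rw [hord, hord, hord]
        congr 1
        apply propext
        split_ifs <;> omega
    simp only [g]
    rw [h3, h2, h1]
    simp only [hfi, Bool.not_not]
    ring
  · rintro ⟨τ, i⟩ _ _ h
    have := congrFun (congrArg Prod.fst h) i
    simp [flp] at this
  · intro _ _; exact Finset.mem_univ _
  · rintro ⟨τ, i⟩ _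
    simp only [Prod.mk.injEq, and_true]
    funext j
    by_cases hj : j = i
    · subst hj; simp [flp]
    · simp [flp, hj]

lemma lower_bound (G : SimpleGraph V) (q : Fin n → Bool → V)
    (hq : ∀ i a j b, q i a = q j b → i = j ∧ a = b)
    (hadj : ∀ i, G.Adj (q i false) (q i true))
    (hnadj : ∀ i a j b, G.Adj (q i a) (q j b) → i = j)
    (F : GradedFreeResolution (edgeIdeal K G)) (d : ℤ)
    (hF : ∀ i (k : Fin (F.rank i)), (F.deg i k : ℤ) ≤ d + i) : (n : ℤ) ≤ d := by
  by_contra hlt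
  obtain ⟨ord, ho, hord⟩ := exists_ord q hq
  let f0 : Fin n → Bool := fun _ => false
  let z : Finset V → MvPolynomial V K := fun A =>
    if A = tr q f0 then monomial (tex q (cpl f0)) 1 else 0
  have hcard : ∀ τ, (tr q τ).card = n := by
    intro τ
    rw [tr, Finset.card_image_of_injective, Finset.card_univ, Fintype.card_fin]
    intro i j h
    exact (hq _ _ _ _ h).1
  have hdegtex : ∀ τ, (tex q τ).degree = n := by
    intro τ
    simp [tex]
  have hzI : ∀ A, kd ord z A ∈ edgeIdeal K G := by
    intro A
    refine sum_mem fun v hv => ?_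
    apply Ideal.mul_mem_left
    by_cases hA : insert v A = tr q f0
    · have hvt : v ∈ tr q f0 := by rw [← hA]; simp
      simp only [tr, Finset.mem_image, Finset.mem_univ, true_and] at hvt
      obtain ⟨i, rfl⟩ := hvt
      simp only [z]
      rw [if_pos hA, edgeIdeal_eq, X, monomial_mul]
      apply monomial_mem_MI
      left
      refine ⟨q i false, q i true, hadj i, Finset.mem_univ _, Finset.mem_univ _, ?_, ?_⟩
      · rw [Finsupp.add_apply]
        simp [f0]
      · have : tex q (cpl f0) (q i true) ≠ 0 := by
          rw [tex_apply]
          simp only [tr, Finset.mem_image, Finset.mem_univ, true_and]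
          exact ⟨i, by simp [cpl, f0]⟩
        rw [Finsupp.add_apply]
        omega
    · simp only [z]
      rw [if_neg hA, mul_zero]
      exact zero_mem _
  obtain ⟨w, y, _, hwy⟩ := zigzag ho F (2 * n) n 0 (fun _ => z) (by
      intro k A hA
      simp only [z]
      rw [if_neg]
      rintro rfl
      exact hA (hcard _)) (by
      intro k A
      simp only [z]
      split_ifs
      · right
        refine ⟨n, by rw [F.deg_zero]; omega, ?_⟩
        apply isHomogeneous_monomial
        exact hdegtex _
      · exact HH.zero _ _) (by
      intro A
      exact (F.range_zero _).mp (hzI A)) (by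
      intro m hm k
      have := hF m k
      omega)
  let k0 : Fin (F.rank 0) := ⟨0, by rw [F.rank_zero]; exact Nat.one_pos⟩
  have hsub : ∀ k : Fin (F.rank 0), k = k0 := by
    intro k
    have h1 := k.2
    have h2 := F.rank_zero
    apply Fin.ext
    simp only [k0]
    omega
  have hmem : ∀ A, (F.mat 0).mulVec (y A) k0 ∈ edgeIdeal K G := by
    intro A
    rw [F.range_zero]
    refine ⟨y A, ?_⟩
    funext k
    rw [hsub k]; rfl
  have h1 : Phi q z = 1 := by
    rw [Phi, Finset.sum_eq_single f0]
    · simp [z]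
    · intro τ _ hτ
      simp only [z]
      rw [if_neg, coeff_zero]
      intro h
      apply hτ
      funext i
      have : q i (τ i) ∈ tr q f0 := by
        rw [← h]
        simp only [tr, Finset.mem_image, Finset.mem_univ, true_and]
        exact ⟨i, rfl⟩
      simp only [tr, Finset.mem_image, Finset.mem_univ, true_and] at this
      obtain ⟨j, hj⟩ := this
      exact (hq _ _ _ _ hj).2.symm
    · intro h; exact absurd (Finset.mem_univ _) h
  have h2 : Phi q z = Phi q (kd ord (w k0)) +
      Phi q (fun A => (F.mat 0).mulVec (y A) k0) := by
    rw [Phi, Phi, Phi, ← Finset.sum_add_distrib]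
    refine Finset.sum_congr rfl fun τ _ => ?_
    rw [← coeff_add]
    exact congrArg _ (hwy k0 _)
  have h3 : Phi q (fun A => (F.mat 0).mulVec (y A) k0) = 0 := by
    apply Finset.sum_eq_zero
    intro τ _
    by_contra hne
    have hm : (F.mat 0).mulVec (y (tr q τ)) k0 ∈ JJ G K Finset.univ ∅ :=
      (edgeIdeal_eq (K := K) G).le (hmem (tr q τ))
    rcases hm _ (mem_support_iff.mpr hne) with ⟨u, v, a1, _, _, a4, a5⟩ | ⟨v, a1, _⟩
    · rw [tex_apply] at a4 a5
      simp only [tr, Finset.mem_image, Finset.mem_univ, true_and] at a4 a5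
      obtain ⟨i, rfl⟩ := a4
      obtain ⟨j, rfl⟩ := a5
      have := hnadj _ _ _ _ a1
      subst this
      exact a1.ne rfl
    · simp at a1
  rw [h1, Phi_kd q hq hord, h3, add_zero] at h2
  exact one_ne_zero h2

end Lower
end EdgeIdealReg

namespace EdgeIdealReg
open scoped Classical

lemma edgeIdeal_ne_top {V K : Type} [Field K] [Fintype V] (G : SimpleGraph V) :
    edgeIdeal K G ≠ ⊤ := by
  intro h
  have h1 : (1 : MvPolynomial V K) ∈ JJ G K Finset.univ ∅ := by
    apply (edgeIdeal_eq (K := K) G).le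
    rw [h]; trivial
  rcases h1 0 (by rw [mem_support_iff]; simp) with ⟨u, v, _, _, _, a4, _⟩ | ⟨y, _, a2⟩
  · simp at a4
  · simp at a2

lemma exists_family {V : Type} (G : SimpleGraph V) (M : Finset (Sym2 V))
    (hM : IsInducedMatchingSet G M) : ∃ q : Fin M.card → Bool → V,
    (∀ i a j b, q i a = q j b → i = j ∧ a = b) ∧ (∀ i, G.Adj (q i false) (q i true)) ∧
    (∀ i a j b, G.Adj (q i a) (q j b) → i = j) := by
  have hrep : ∀ e : Sym2 V, ∃ u v, e = s(u, v) := by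
    intro e
    induction e with | _ u v => exact ⟨u, v, rfl⟩
  choose u v huv using hrep
  let E : Fin M.card → Sym2 V := fun i => (M.equivFin.symm i : Sym2 V)
  have hE : ∀ i, E i ∈ M := fun i => (M.equivFin.symm i).2
  have hinj : ∀ i j, E i = E j → i = j := by
    intro i j h
    exact M.equivFin.symm.injective (Subtype.ext h)
  let q : Fin M.card → Bool → V := fun i b => cond b (v (E i)) (u (E i))
  have hqm : ∀ i b, q i b ∈ E i := by
    intro i b
    rw [huv (E i), Sym2.mem_iff]
    cases b
    · left; rfl
    · right; rfl
  have hadj : ∀ i, G.Adj (q i false) (q i true) := by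
    intro i
    have := hM.1.1 (hE i)
    rw [huv (E i)] at this
    exact this
  refine ⟨q, ?_, hadj, ?_⟩
  · intro i a j b h
    have hij : i = j := by
      by_contra hne
      exact hM.1.2 (hE i) (hE j) (fun h => hne (hinj _ _ h)) _ (hqm i a) (h ▸ hqm j b)
    refine ⟨hij, ?_⟩
    subst hij
    cases a <;> cases b
    · rfl
    · exact absurd h (hadj i).ne
    · exact absurd h.symm (hadj i).ne
    · rfl
  · intro i a j b h
    by_contra hne
    exact hM.2 (hE i) (hE j) (fun h => hne (hinj _ _ h)) _ _ (hqm i a) (hqm j b) h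

theorem main_aux {V K : Type} [Field K] [Fintype V]
    (G : SimpleGraph V) (Hset T : Set V) (huni : Unicyclic (G.induce Hset))
    (hlen : ∀ (w : Hset) (c : (G.induce Hset).Walk w w), c.IsCycle → c.length % 3 ≠ 2)
    (hatt : Nonempty (CliqueAttachment G Hset T)) :
    regQuot (edgeIdeal K G) = (((inducedMatchingNumber G : ℤ)) : WithBot ℤ) := by
  have hbdd : BddAbove { n | ∃ M, IsInducedMatchingSet G M ∧ M.card = n } := by
    refine ⟨Fintype.card (Sym2 V), ?_⟩
    rintro n ⟨M, _, rfl⟩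
    exact Finset.card_le_univ M
  have hne : { n | ∃ M, IsInducedMatchingSet G M ∧ M.card = n }.Nonempty :=
    ⟨0, ∅, (IM.empty (G := G) Finset.univ).1, rfl⟩
  have hmax : ∀ M, IsInducedMatchingSet G M → M.card ≤ inducedMatchingNumber G :=
    fun M hM => le_csSup hbdd ⟨M, hM, rfl⟩
  obtain ⟨M, hM, hc⟩ : ∃ M, IsInducedMatchingSet G M ∧ M.card = inducedMatchingNumber G :=
    Nat.sSup_mem hne hbdd
  rw [regQuot, if_neg (edgeIdeal_ne_top G)]
  congr 1
  apply IsLeast.csInf_eq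
  constructor
  · obtain ⟨n, hn⟩ := reg_upper (K := K) G Hset T huni hlen hatt _ Finset.univ rfl
      (inducedMatchingNumber G) (fun M hM => hmax M hM.1) ∅ (Finset.disjoint_empty_left _)
    rw [edgeIdeal_eq]
    exact hn.toResolution
  · rintro d ⟨F, hF⟩
    obtain ⟨q, h1, h2, h3⟩ := exists_family G M hM
    rw [← hc]
    exact lower_bound G q h1 h2 h3 F d hF

end EdgeIdealReg

open EdgeIdealReg in
/-- If `H` is unicyclic with cycle length `n ≡ 0, 1 (mod 3)` and `G = H_T` is obtained by
attaching unions of complete graphs at the vertices of `T ⊆ V(H)`, then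
`reg(S/I(G)) = ν(G)`. -/
theorem reg_unicyclic_attached_eq_nu {V K : Type} [Field K] [Fintype V] [DecidableEq V]
    (G : SimpleGraph V) (Hset T : Set V) (huni : Unicyclic (G.induce Hset))
    (hlen : ∀ (w : Hset) (c : (G.induce Hset).Walk w w), c.IsCycle → c.length % 3 ≠ 2)
    (hatt : Nonempty (CliqueAttachment G Hset T)) :
    regQuot (edgeIdeal K G) = (((inducedMatchingNumber G : ℤ)) : WithBot ℤ) := by
  exact main_aux G Hset T huni hlen hatt
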